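/- In the setting of the random ReLU network with ‖x‖ = √d, d_min ≥ (Cℓ log d_max)^{240ℓ} log(1/δ), R = √(d_min)/(ℓ log d_max)^{80ℓ}, bottleneck indices i₁ > i₂ > ⋯ > i_m = 0, and M_{i,j}(y) = ∏_{k=i}^{j+1} D_k(f̃_k(y)) W_k for i > j, the following holds: with probability at least 1 − δ over the weight matrices {W_k}, for every y with ‖y − x‖ ≤ R and every j ∈ [m−1], almost surely over the randomized tie-breaking in the activations, ‖M_{i_j, i_{j+1}}(y)‖ ≤ (C·ℓ·log d_max)^{(i_j − i_{j+1})/2}. -/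

import Mathlib

open MeasureTheory ProbabilityTheory

noncomputable section

/-- Euclidean norm of a finite real vector. -/
def evNorm {n : ℕ} (v : Fin n → ℝ) : ℝ := Real.sqrt (∑ i, v i ^ 2)

/-- Matrix-vector product. -/
def mulVecFn {a b : ℕ} (M : Fin a → Fin b → ℝ) (v : Fin b → ℝ) : Fin a → ℝ :=
  fun j => ∑ k, M j k * v k

/-- Spectral (ℓ²-operator) norm of a matrix. -/
def specNorm {a b : ℕ} (M : Fin a → Fin b → ℝ) : ℝ :=
  sSup {t | ∃ v : Fin b → ℝ, evNorm v ≤ 1 ∧ t = evNorm (mulVecFn M v)}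

/-- The law of an `a × b` random matrix with i.i.d. centered Gaussian entries of variance `v`. -/
def gaussMat (a b : ℕ) (v : NNReal) : Measure (Fin a → Fin b → ℝ) :=
  Measure.pi fun _ => Measure.pi fun _ => gaussianReal 0 v

instance (a b : ℕ) (v : NNReal) : IsProbabilityMeasure (gaussMat a b v) := by
  unfold gaussMat; infer_instance

/-- Post-activation output of layer `i` of a fully connected ReLU network. -/
def forward (D : ℕ → ℕ) (w : ∀ i : ℕ, Fin (D (i+1)) → Fin (D i) → ℝ) :
    (i : ℕ) → (Fin (D 0) → ℝ) → Fin (D i) → ℝ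
  | 0, x => x
  | (i+1), x => fun j => max (∑ k, w i j k * forward D w i x k) 0

/-- Pre-activation input to layer `i+1` (the quantity `f̃_{i+1}`). -/
def preact (D : ℕ → ℕ) (w : ∀ i : ℕ, Fin (D (i+1)) → Fin (D i) → ℝ)
    (i : ℕ) (x : Fin (D 0) → ℝ) : Fin (D (i+1)) → ℝ :=
  fun j => ∑ k, w i j k * forward D w i x k

/-- Extend a finitely-indexed family of weight matrices to all of `ℕ` (zero beyond `ℓ`). -/
def extendW (ℓ : ℕ) (D : ℕ → ℕ)
    (w : ∀ i : Fin ℓ, Fin (D (i.1+1)) → Fin (D i.1) → ℝ) :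
    ∀ i : ℕ, Fin (D (i+1)) → Fin (D i) → ℝ :=
  fun i => if h : i < ℓ then w ⟨i, h⟩ else fun _ _ => 0

/-- Law of the hidden-layer weight matrices `W_1, …, W_ℓ`. -/
def hiddenMeasure (ℓ : ℕ) (D : ℕ → ℕ) :
    Measure (∀ i : Fin ℓ, Fin (D (i.1+1)) → Fin (D i.1) → ℝ) :=
  Measure.pi fun i => gaussMat (D (i.1+1)) (D i.1) (1 / (D i.1 : NNReal))

/-- Minimum width among layers `0,…,ℓ`. -/
def dminN (ℓ : ℕ) (D : ℕ → ℕ) : ℕ := sInf (D '' Set.Iic ℓ)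

/-- Maximum width among layers `0,…,ℓ`. -/
def dmaxN (ℓ : ℕ) (D : ℕ → ℕ) : ℕ := sSup (D '' Set.Iic ℓ)

/-- The radius `R = √(d_min)/(ℓ log d_max)^{80ℓ}`. -/
def Rball (ℓ : ℕ) (D : ℕ → ℕ) : ℝ :=
  Real.sqrt (dminN ℓ D) / ((ℓ : ℝ) * Real.log (dmaxN ℓ D)) ^ (80 * (ℓ : ℝ))

/-- The least index `i < n` minimizing `D i` (junk value `0` when `n = 0`). -/
def argminLt (D : ℕ → ℕ) (n : ℕ) : ℕ := sInf {i | i < n ∧ ∀ j, j < n → D i ≤ D j}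

/-- Bottleneck indices: `bn D ℓ 0 = ℓ+1`, `bn D ℓ (j+1) = argmin_{i < bn D ℓ j} d_i`. -/
def bn (D : ℕ → ℕ) (ℓ : ℕ) : ℕ → ℕ
  | 0 => ℓ + 1
  | (j+1) => argminLt D (bn D ℓ j)

/-- Diagonal entry of the randomized activation-pattern matrix: `1` if the pre-activation is
positive, the tie-breaking `bit` if it vanishes, and `0` otherwise. -/
def act01 (s : ℝ) (bit : Bool) : ℝ :=
  if 0 < s then 1 else if s = 0 ∧ bit = true then 1 else 0

/-- `Mprod D w b y j i = ∏_{k=i}^{j+1} D_k(f̃_k(y)) W_k`, the masked chain product mapping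
layer `j` to layer `i` (identity when `i = j`), with tie-breaking bits `b`. -/
def Mprod (D : ℕ → ℕ) (w : ∀ i : ℕ, Fin (D (i+1)) → Fin (D i) → ℝ)
    (b : ∀ i : ℕ, Fin (D (i+1)) → Bool) (y : Fin (D 0) → ℝ) (j : ℕ) :
    (i : ℕ) → Fin (D i) → Fin (D j) → ℝ
  | 0 => fun a c => if 0 = j ∧ (a : ℕ) = (c : ℕ) then 1 else 0
  | (t+1) =>
      if t + 1 = j then (fun a c => if (a : ℕ) = (c : ℕ) then 1 else 0)
      else fun a c =>
        act01 (preact D w t y a) (b t a) * (∑ k, w t a k * Mprod D w b y j t k c)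

/-- The fair-coin distribution on `Bool`. -/
def coin : Measure Bool := (PMF.bernoulli (1/2) (by norm_num)).toMeasure

instance : IsProbabilityMeasure coin := by unfold coin; infer_instance

/-- The law of the independent fair tie-breaking bits of the hidden layers. -/
def bitsMeasure (ℓ : ℕ) (D : ℕ → ℕ) : Measure (∀ i : Fin ℓ, Fin (D (i.1+1)) → Bool) :=
  Measure.pi fun _ => Measure.pi fun _ => coin

/-- Extend a finitely-indexed family of bits to all of `ℕ`. -/
def extendB (ℓ : ℕ) (D : ℕ → ℕ) (b : ∀ i : Fin ℓ, Fin (D (i.1+1)) → Bool) :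
    ∀ i : ℕ, Fin (D (i+1)) → Bool :=
  fun i => if h : i < ℓ then b ⟨i, h⟩ else fun _ => false


lemma pi_map_update {ι : Type*} [Fintype ι] [DecidableEq ι] {X : ι → Type*}
    [∀ i, MeasurableSpace (X i)] (μ : ∀ i, Measure (X i)) [∀ i, IsProbabilityMeasure (μ i)] (i : ι) :
    Measure.map (fun q : (∀ i, X i) × X i => Function.update q.1 i q.2)
      ((Measure.pi μ).prod (μ i)) = Measure.pi μ := by
  have hm : Measurable (fun q : (∀ i, X i) × X i => Function.update q.1 i q.2) :=
    measurable_update'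
  symm
  apply Measure.pi_eq
  intro s hs
  rw [Measure.map_apply hm (MeasurableSet.univ_pi hs)]
  have : (fun q : (∀ i, X i) × X i => Function.update q.1 i q.2) ⁻¹' (Set.univ.pi s)
      = (Set.univ.pi (Function.update s i Set.univ)) ×ˢ (s i) := by
    ext ⟨w, a⟩
    simp only [Set.mem_preimage, Set.mem_pi, Set.mem_univ, true_implies, Set.mem_prod]
    constructor
    · intro h
      refine ⟨fun j => ?_, by simpa using h i⟩
      by_cases hj : j = i
      · subst hj; simp
      · simpa [hj] using h j
    · rintro ⟨h1, h2⟩ j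
      by_cases hj : j = i
      · subst hj; simpa using h2
      · simpa [hj] using h1 j
  rw [this, Measure.prod_prod, Measure.pi_pi]
  rw [← Finset.mul_prod_erase Finset.univ _ (Finset.mem_univ i),
    ← Finset.mul_prod_erase Finset.univ (fun j => μ j (s j)) (Finset.mem_univ i)]
  simp only [Function.update_self, measure_univ, one_mul]
  rw [mul_comm]
  congr 1
  apply Finset.prod_congr rfl
  intro j hj
  rw [Function.update_of_ne (Finset.ne_of_mem_erase hj)]

lemma pi_update_bound {ι : Type*} [Fintype ι] [DecidableEq ι] {X : ι → Type*}
    [∀ i, MeasurableSpace (X i)] (μ : ∀ i, Measure (X i)) [∀ i, IsProbabilityMeasure (μ i)] (i : ι)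
    (S T : Set (∀ i, X i)) (hS : MeasurableSet S) (hT : MeasurableSet T)
    (hind : ∀ w a, w ∈ S → Function.update w i a ∈ S) (ε : ENNReal)
    (h : ∀ w, μ i {a | Function.update w i a ∈ T} ≤ ε) :
    Measure.pi μ (S ∩ T) ≤ ε * Measure.pi μ S := by
  have hm : Measurable (fun q : (∀ i, X i) × X i => Function.update q.1 i q.2) :=
    measurable_update'
  conv_lhs => rw [← pi_map_update μ i]
  rw [Measure.map_apply hm (hS.inter hT), Measure.prod_apply (hm (hS.inter hT))]
  calc _ ≤ ∫⁻ w, S.indicator (fun _ => ε) w ∂(Measure.pi μ) := by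
        apply lintegral_mono
        intro w
        by_cases hw : w ∈ S
        · rw [Set.indicator_of_mem hw]
          exact (measure_mono (fun a ha => ha.2)).trans (h w)
        · rw [Set.indicator_of_notMem hw]
          have : (Prod.mk w ⁻¹' ((fun q : (∀ i, X i) × X i => Function.update q.1 i q.2) ⁻¹'
              (S ∩ T))) = ∅ := by
            ext a
            simp only [Set.mem_preimage, Set.mem_inter_iff, Set.mem_empty_iff_false, iff_false]
            intro hc
            apply hw
            have := hind _ (w i) hc.1
            simpa using this
          beta_reduce; rw [this]; simp
    _ = _ := by rw [lintegral_indicator hS]; simp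

lemma measurable_closed_proj {X : Type*} [TopologicalSpace X] [MeasurableSpace X]
    [OpensMeasurableSpace X] {d : ℕ} (K : Set (X × (Fin d → ℝ))) (hK : IsClosed K) :
    MeasurableSet {x | ∃ z, (x, z) ∈ K} := by
  have : {x | ∃ z, (x, z) ∈ K} = ⋃ n : ℕ, (Prod.fst '' ((fun q : X × (Metric.closedBall (0 : Fin d → ℝ) n) => (q.1, (q.2 : Fin d → ℝ))) ⁻¹' K)) := by
    ext x
    simp only [Set.mem_ofPred_eq, Set.mem_iUnion, Set.mem_image, Set.mem_preimage, Prod.exists,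
      exists_and_right, exists_eq_right, Subtype.exists]
    constructor
    · rintro ⟨z, hz⟩
      obtain ⟨n, hn⟩ := exists_nat_ge ‖z‖
      exact ⟨n, z, by simpa using hn, hz⟩
    · rintro ⟨n, z, _, hz⟩
      exact ⟨z, hz⟩
  rw [this]
  refine MeasurableSet.iUnion fun n => ?_
  have : CompactSpace (Metric.closedBall (0 : Fin d → ℝ) n) :=
    isCompact_iff_compactSpace.1 (isCompact_closedBall _ _)
  refine (isClosedMap_fst_of_compactSpace _ (hK.preimage ?_)).measurableSet
  fun_prop

lemma pi_ac {α : Type*} [MeasurableSpace α] : ∀ (n : ℕ) (μ ν : Fin n → Measure α)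
    [∀ i, SigmaFinite (μ i)] [∀ i, SigmaFinite (ν i)], (∀ i, μ i ≪ ν i) →
    Measure.pi μ ≪ Measure.pi ν := by
  intro n
  induction n with
  | zero =>
    intro μ ν _ _ h
    rw [Measure.pi_of_empty, Measure.pi_of_empty]
  | succ n ih =>
    intro μ ν _ _ h
    have h1 := (measurePreserving_piFinSuccAbove μ 0).symm
    have h2 := (measurePreserving_piFinSuccAbove ν 0).symm
    rw [← h1.map_eq, ← h2.map_eq]
    apply Measure.AbsolutelyContinuous.map _ h1.measurable
    exact Measure.AbsolutelyContinuous.prod (h 0) (ih _ _ (fun i => h _))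


/-- squared Euclidean norm -/
def nsq {n : ℕ} (v : Fin n → ℝ) : ℝ := ∑ i, v i ^ 2

lemma nsq_nonneg {n : ℕ} (v : Fin n → ℝ) : 0 ≤ nsq v := Finset.sum_nonneg fun _ _ => sq_nonneg _

lemma row_law {b : ℕ} (v : NNReal) (u : Fin b → ℝ) :
    Measure.map (fun r : Fin b → ℝ => ∑ k, r k * u k) (Measure.pi fun _ => gaussianReal 0 v)
      = gaussianReal 0 (v * (nsq u).toNNReal) := by
  have hm : Measurable (fun r : Fin b → ℝ => ∑ k, r k * u k) := by fun_prop
  have : IsProbabilityMeasure (Measure.map (fun r : Fin b → ℝ => ∑ k, r k * u k)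
    (Measure.pi fun _ => gaussianReal 0 v)) := Measure.isProbabilityMeasure_map hm.aemeasurable
  apply Measure.ext_of_charFun
  ext t
  rw [charFun_gaussianReal, charFun_apply_real, integral_map hm.aemeasurable (by fun_prop)]
  have h1 : ∀ r : Fin b → ℝ, Complex.exp (t * ((∑ k, r k * u k : ℝ) : ℂ) * Complex.I)
      = ∏ k, Complex.exp (((t * u k : ℝ) : ℂ) * (r k : ℂ) * Complex.I) := by
    intro r
    rw [← Complex.exp_sum]
    congr 1
    push_cast
    rw [Finset.mul_sum, Finset.sum_mul]
    apply Finset.sum_congr rfl; intros; ring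
  simp_rw [h1]
  rw [integral_fintype_prod_eq_prod (f := fun k (x : ℝ) => Complex.exp (((t * u k : ℝ) : ℂ) * (x : ℂ) * Complex.I))]
  have h2 : ∀ k, ∫ x : ℝ, Complex.exp (((t * u k : ℝ) : ℂ) * (x : ℂ) * Complex.I) ∂(gaussianReal 0 v)
      = Complex.exp (- (v * (t * u k)^2 / 2)) := by
    intro k
    rw [← charFun_apply_real, charFun_gaussianReal]
    congr 1
    push_cast; ring
  simp_rw [h2]
  rw [← Complex.exp_sum]
  congr 1
  have h3 : (((v * (nsq u).toNNReal : NNReal) : ℝ) : ℂ) = v * ∑ k, (u k : ℂ)^2 := by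
    push_cast
    rw [Real.coe_toNNReal _ (nsq_nonneg u)]
    simp [nsq]
  have h4 : ((v * (nsq u).toNNReal : NNReal) : ℂ) = v * ∑ k, (u k : ℂ)^2 := by
    rw [← h3]
  rw [h4, Finset.mul_sum]
  simp only [Complex.ofReal_zero, mul_zero, zero_mul, zero_sub]
  rw [Finset.sum_mul, Finset.sum_div, Finset.sum_neg_distrib]
  congr 1
  apply Finset.sum_congr rfl; intros; ring

lemma mat_prod_lintegral {a b : ℕ} (v : NNReal) (u : Fin b → ℝ) (φ : ℝ → ENNReal)
    (hφ : Measurable φ) :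
    ∫⁻ A, ∏ j, φ (mulVecFn A u j) ∂(gaussMat a b v)
      = (∫⁻ x, φ x ∂(gaussianReal 0 (v * (nsq u).toNNReal))) ^ a := by
  have hm : Measurable (fun r : Fin b → ℝ => ∑ k, r k * u k) := by fun_prop
  have hi : iIndepFun (fun (j : Fin a) (A : Fin a → Fin b → ℝ) => φ (∑ k, A j k * u k))
      (gaussMat a b v) := by
    unfold gaussMat
    exact iIndepFun_pi (X := fun (j : Fin a) (r : Fin b → ℝ) => φ (∑ k, r k * u k))
      (fun j => (hφ.comp hm).aemeasurable)
  have := lintegral_prod_eq_prod_lintegral_of_indepFun Finset.univ _ hi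
    (fun j => hφ.comp (hm.comp (measurable_pi_apply j)))
  unfold mulVecFn
  rw [this]
  have h2 : ∀ j : Fin a, ∫⁻ A, φ (∑ k, A j k * u k) ∂(gaussMat a b v)
      = ∫⁻ x, φ x ∂(gaussianReal 0 (v * (nsq u).toNNReal)) := by
    intro j
    rw [← row_law, lintegral_map hφ hm]
    unfold gaussMat
    have hp := measurePreserving_eval (fun _ : Fin a => Measure.pi fun _ : Fin b => gaussianReal 0 v) j
    exact hp.lintegral_comp (f := fun r : Fin b → ℝ => φ (∑ k, r k * u k)) (hφ.comp hm)
  simp_rw [h2]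
  simp

lemma gauss_mgf (σ : NNReal) (hσ : σ ≠ 0) (θ : ℝ) (hθ : 0 < 1 + 2 * θ) :
    ∫⁻ x, ENNReal.ofReal (Real.exp (-(θ / σ) * x ^ 2)) ∂(gaussianReal 0 σ)
      = ENNReal.ofReal ((Real.sqrt (1 + 2 * θ))⁻¹) := by
  have hσ' : (0:ℝ) < σ := by positivity
  have hb : 0 < (1 + 2 * θ) / (2 * σ) := by positivity
  rw [gaussianReal_of_var_ne_zero _ hσ,
    lintegral_withDensity_eq_lintegral_mul _ (measurable_gaussianPDF _ _) (by fun_prop)]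
  have : ∀ x : ℝ, (gaussianPDF 0 σ * fun x => ENNReal.ofReal (Real.exp (-(θ / σ) * x ^ 2))) x
      = ENNReal.ofReal ((Real.sqrt (2 * Real.pi * σ))⁻¹ * Real.exp (-((1 + 2 * θ) / (2 * σ)) * x ^ 2)) := by
    intro x
    simp only [Pi.mul_apply, gaussianPDF, gaussianPDFReal]
    rw [← ENNReal.ofReal_mul (by positivity), mul_assoc, ← Real.exp_add]
    congr 3
    field_simp
    ring
  simp_rw [this]
  rw [← ofReal_integral_eq_lintegral_ofReal ((integrable_exp_neg_mul_sq hb).const_mul _)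
    (Filter.Eventually.of_forall fun x => by positivity)]
  congr 1
  rw [integral_const_mul, integral_gaussian]
  rw [← Real.sqrt_inv, ← Real.sqrt_mul (by positivity), ← Real.sqrt_inv]
  congr 1
  field_simp

lemma mulVecFn_zero_of_nsq {a b : ℕ} (A : Fin a → Fin b → ℝ) (u : Fin b → ℝ) (h : nsq u = 0) :
    mulVecFn A u = 0 := by
  have : u = 0 := by
    unfold nsq at h
    rw [Finset.sum_eq_zero_iff_of_nonneg (fun _ _ => sq_nonneg _)] at h
    ext i; simpa using h i (Finset.mem_univ i)
  subst this
  ext; simp [mulVecFn]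

lemma measurable_mulVecFn_apply {a b : ℕ} (u : Fin b → ℝ) (j : Fin a) :
    Measurable fun A : Fin a → Fin b → ℝ => mulVecFn A u j := by
  unfold mulVecFn; fun_prop

lemma ennreal_exp_move (x c : ENNReal) (t : ℝ) (h : ENNReal.ofReal (Real.exp t) * x ≤ c) :
    x ≤ ENNReal.ofReal (Real.exp (-t)) * c := by
  calc x = ENNReal.ofReal (Real.exp (-t)) * (ENNReal.ofReal (Real.exp t) * x) := by
        rw [← mul_assoc, ← ENNReal.ofReal_mul (Real.exp_pos _).le, ← Real.exp_add]
        simp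
    _ ≤ _ := by gcongr

lemma chi_upper {a b : ℕ} (v : NNReal) (hv : v ≠ 0) (u : Fin b → ℝ) (B : ℝ) :
    gaussMat a b v {A | B * v * nsq u < nsq (mulVecFn A u)}
      ≤ ENNReal.ofReal (Real.exp (-B / 4) * Real.sqrt 2 ^ a) := by
  by_cases hu : nsq u = 0
  · have : {A : Fin a → Fin b → ℝ | B * v * nsq u < nsq (mulVecFn A u)} = ∅ := by
      ext A
      simp only [Set.mem_ofPred_eq, Set.mem_empty_iff_false, iff_false]
      rw [mulVecFn_zero_of_nsq A u hu, hu]; simp [nsq]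
    rw [this]; simp
  have hu' : 0 < nsq u := lt_of_le_of_ne (nsq_nonneg u) (Ne.symm hu)
  set σ : NNReal := v * (nsq u).toNNReal with hσd
  have hσr : (σ : ℝ) = v * nsq u := by simp [hσd, Real.coe_toNNReal _ hu'.le]
  have hv' : (0:ℝ) < v := by positivity
  have hσ : σ ≠ 0 := by
    have : (0:ℝ) < σ := by rw [hσr]; positivity
    exact_mod_cast this.ne'
  have hσp : (0:ℝ) < σ := by positivity
  have key := mat_prod_lintegral (a := a) v u (fun x => ENNReal.ofReal (Real.exp (-((-1/4) / σ) * x ^ 2))) (by fun_prop)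
  rw [gauss_mgf σ hσ (-1/4) (by norm_num)] at key
  have hs2 : (Real.sqrt (1 + 2 * (-1/4)))⁻¹ = Real.sqrt 2 := by
    rw [← Real.sqrt_inv]; norm_num
  rw [hs2] at key
  have hprod : ∀ A : Fin a → Fin b → ℝ, ∏ j, ENNReal.ofReal (Real.exp (-((-1/4) / σ) * (mulVecFn A u j) ^ 2))
      = ENNReal.ofReal (Real.exp (nsq (mulVecFn A u) / (4 * σ))) := by
    intro A
    rw [← ENNReal.ofReal_prod_of_nonneg (fun _ _ => (Real.exp_pos _).le), ← Real.exp_sum]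
    congr 2
    rw [← Finset.mul_sum, nsq]; field_simp
  simp_rw [hprod] at key
  have hmeas : Measurable fun A : Fin a → Fin b → ℝ => ENNReal.ofReal (Real.exp (nsq (mulVecFn A u) / (4 * σ))) := by
    have := measurable_mulVecFn_apply (a := a) u
    unfold nsq; fun_prop
  have hmk := mul_meas_ge_le_lintegral (μ := gaussMat a b v) hmeas (ENNReal.ofReal (Real.exp (B / 4)))
  rw [key] at hmk
  have hsub : {A : Fin a → Fin b → ℝ | B * v * nsq u < nsq (mulVecFn A u)} ⊆
      {A | ENNReal.ofReal (Real.exp (B / 4)) ≤ ENNReal.ofReal (Real.exp (nsq (mulVecFn A u) / (4 * σ)))} := by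
    intro A hA
    simp only [Set.mem_ofPred_eq] at hA ⊢
    apply ENNReal.ofReal_le_ofReal
    apply Real.exp_le_exp.2
    rw [div_le_div_iff₀ (by norm_num) (by positivity), hσr]
    nlinarith
  rw [ENNReal.ofReal_mul (Real.exp_pos _).le, ENNReal.ofReal_pow (Real.sqrt_nonneg _)]
  rw [neg_div]
  exact (measure_mono hsub).trans (ennreal_exp_move _ _ _ hmk)

lemma relu_mgf (σ : NNReal) (hσ : σ ≠ 0) :
    ∫⁻ x, ENNReal.ofReal (Real.exp (-(4 / σ) * (max x 0) ^ 2)) ∂(gaussianReal 0 σ)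
      = ENNReal.ofReal (2 / 3) := by
  set I := ∫⁻ x, ENNReal.ofReal (Real.exp (-(4 / σ) * (max x 0) ^ 2)) ∂(gaussianReal 0 σ) with hI
  have h1 : I = ∫⁻ x, ENNReal.ofReal (Real.exp (-(4 / σ) * (max (-x) 0) ^ 2)) ∂(gaussianReal 0 σ) := by
    have hg : gaussianReal 0 σ = (gaussianReal 0 σ).map (fun x => -x) := by
      rw [gaussianReal_map_neg]; simp
    rw [hI]
    conv_lhs => rw [hg]
    rw [lintegral_map (by fun_prop) (by fun_prop)]
  have h2 : I + I = 1 + ENNReal.ofReal (1/3) := by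
    conv_lhs => rw [hI]
    conv_lhs => arg 2; rw [← hI, h1]
    rw [← lintegral_add_left (by fun_prop)]
    have h3 : ∀ x : ℝ, ENNReal.ofReal (Real.exp (-(4 / σ) * (max x 0) ^ 2)) + ENNReal.ofReal (Real.exp (-(4 / σ) * (max (-x) 0) ^ 2)) = 1 + ENNReal.ofReal (Real.exp (-(4 / σ) * x ^ 2)) := by
      intro x
      rcases le_total 0 x with hx | hx
      · rw [max_eq_left hx, max_eq_right (by linarith : -x ≤ 0)]; simp [add_comm]
      · rw [max_eq_right hx, max_eq_left (by linarith : 0 ≤ -x)]; simp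
    simp_rw [h3]
    rw [lintegral_add_left (by fun_prop), gauss_mgf σ hσ 4 (by norm_num)]
    simp only [lintegral_const, measure_univ, mul_one]
    congr 2
    rw [show (1 + 2 * 4 : ℝ) = 3 ^ 2 by norm_num, Real.sqrt_sq (by norm_num)]; norm_num
  have hfin : I ≠ ⊤ := by
    intro h; rw [h, top_add] at h2
    exact (ENNReal.add_ne_top.2 ⟨ENNReal.one_ne_top, ENNReal.ofReal_ne_top⟩) h2.symm
  rw [← ENNReal.toReal_eq_toReal_iff' hfin ENNReal.ofReal_ne_top]
  have h5 := congrArg ENNReal.toReal h2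
  rw [ENNReal.toReal_add hfin hfin, ENNReal.toReal_add ENNReal.one_ne_top ENNReal.ofReal_ne_top,
    ENNReal.toReal_ofReal (by norm_num)] at h5
  rw [ENNReal.toReal_ofReal (by norm_num)]
  simp at h5
  linarith

lemma relu_lower {a b : ℕ} (v : NNReal) (hv : v ≠ 0) (u : Fin b → ℝ) :
    gaussMat a b v {A | nsq (fun j => max (mulVecFn A u j) 0) < (1 / 40) * a * v * nsq u}
      ≤ ENNReal.ofReal ((3 / 4) ^ a) := by
  by_cases hu : nsq u = 0
  · have : {A : Fin a → Fin b → ℝ | nsq (fun j => max (mulVecFn A u j) 0) < (1 / 40) * a * v * nsq u} = ∅ := by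
      ext A
      simp only [Set.mem_ofPred_eq, Set.mem_empty_iff_false, iff_false]
      rw [hu, mul_zero, not_lt]; exact nsq_nonneg _
    rw [this]; simp
  have hu' : 0 < nsq u := lt_of_le_of_ne (nsq_nonneg u) (Ne.symm hu)
  set σ : NNReal := v * (nsq u).toNNReal with hσd
  have hσr : (σ : ℝ) = v * nsq u := by simp [hσd, Real.coe_toNNReal _ hu'.le]
  have hv' : (0:ℝ) < v := by positivity
  have hσ : σ ≠ 0 := by
    have : (0:ℝ) < σ := by rw [hσr]; positivity
    exact_mod_cast this.ne'
  have hσp : (0:ℝ) < σ := by positivity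
  have key := mat_prod_lintegral (a := a) v u (fun x => ENNReal.ofReal (Real.exp (-(4 / σ) * (max x 0) ^ 2))) (by fun_prop)
  rw [relu_mgf σ hσ] at key
  have hprod : ∀ A : Fin a → Fin b → ℝ, ∏ j, ENNReal.ofReal (Real.exp (-(4 / σ) * (max (mulVecFn A u j) 0) ^ 2))
      = ENNReal.ofReal (Real.exp (-(4 / σ) * nsq (fun j => max (mulVecFn A u j) 0))) := by
    intro A
    rw [← ENNReal.ofReal_prod_of_nonneg (fun _ _ => (Real.exp_pos _).le), ← Real.exp_sum]
    congr 2
    rw [← Finset.mul_sum, nsq]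
  simp_rw [hprod] at key
  have hmeas : Measurable fun A : Fin a → Fin b → ℝ => ENNReal.ofReal (Real.exp (-(4 / σ) * nsq (fun j => max (mulVecFn A u j) 0))) := by
    have := measurable_mulVecFn_apply (a := a) u
    unfold nsq; fun_prop
  have hmk := mul_meas_ge_le_lintegral (μ := gaussMat a b v) hmeas (ENNReal.ofReal (Real.exp (-(a / 10 : ℝ))))
  rw [key] at hmk
  have hsub : {A : Fin a → Fin b → ℝ | nsq (fun j => max (mulVecFn A u j) 0) < (1 / 40) * a * v * nsq u} ⊆
      {A | ENNReal.ofReal (Real.exp (-(a / 10 : ℝ))) ≤ ENNReal.ofReal (Real.exp (-(4 / σ) * nsq (fun j => max (mulVecFn A u j) 0)))} := by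
    intro A hA
    simp only [Set.mem_ofPred_eq] at hA ⊢
    apply ENNReal.ofReal_le_ofReal
    apply Real.exp_le_exp.2
    have : 4 / σ * nsq (fun j => max (mulVecFn A u j) 0) ≤ 4 / σ * ((1 / 40) * a * v * nsq u) := by
      gcongr
    have h2 : 4 / σ * ((1 / 40) * a * v * nsq u) = a / 10 := by
      rw [hσr]; field_simp; ring
    linarith
  have he : Real.exp (1 / 10) ≤ 9 / 8 := by
    have := Real.exp_bound_div_one_sub_of_interval (x := 1/10) (by norm_num) (by norm_num)
    refine this.trans (by norm_num)
  have hfin := (measure_mono hsub).trans (ennreal_exp_move _ _ _ hmk)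
  rw [neg_neg] at hfin
  calc _ ≤ ENNReal.ofReal (Real.exp (a / 10 : ℝ)) * ENNReal.ofReal (2 / 3) ^ a := hfin
    _ = ENNReal.ofReal ((Real.exp (1/10) * (2/3)) ^ a) := by
        rw [← ENNReal.ofReal_pow (by norm_num), ← ENNReal.ofReal_mul (Real.exp_pos _).le, mul_pow, ← Real.exp_nat_mul]
        congr 3; ring_nf
    _ ≤ _ := by
        apply ENNReal.ofReal_le_ofReal
        gcongr
        linarith


lemma gaussMat_ac {a b : ℕ} (v : NNReal) (hv : v ≠ 0) : gaussMat a b v ≪ volume := by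
  unfold gaussMat
  exact pi_ac a _ (fun _ => volume) fun _ => pi_ac b _ (fun _ => volume) fun _ =>
    gaussianReal_absolutelyContinuous 0 hv

lemma gp_null {a b d : ℕ} (v : NNReal) (hv : v ≠ 0) (M : (Fin d → ℝ) →ₗ[ℝ] (Fin b → ℝ))
    (I : Finset (Fin a)) (hI : I.card = d) :
    gaussMat a b v {A | ∃ z, M z ≠ 0 ∧ ∀ j ∈ I, mulVecFn A (M z) j = 0} = 0 := by
  apply gaussMat_ac v hv
  set U := LinearMap.range M
  set r := Module.finrank ℝ U
  have hr : r ≤ d := by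
    have := LinearMap.finrank_range_le M
    simpa using this
  let B := Module.finBasis ℝ U
  -- injection into I
  obtain ⟨e, heinj, heI⟩ : ∃ e : Fin r → Fin a, Function.Injective e ∧ ∀ i, e i ∈ I := by
    refine ⟨fun i => (I.equivFin.symm ⟨i.1, by rw [hI]; exact i.2.trans_le hr⟩ : I), ?_, fun i => Finset.coe_mem _⟩
    intro i j hij
    have h := I.equivFin.symm.injective (Subtype.ext hij)
    simpa [Fin.ext_iff] using h
  let G : (Fin a → Fin b → ℝ) → Matrix (Fin r) (Fin r) ℝ :=
    fun A => Matrix.of fun i k => ∑ l, A (e i) l * (B k : Fin b → ℝ) l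
  have hsub : {A : Fin a → Fin b → ℝ | ∃ z, M z ≠ 0 ∧ ∀ j ∈ I, mulVecFn A (M z) j = 0}
      ⊆ {A | (G A).det ≠ 0}ᶜ := by
    rintro A ⟨z, hz, hA⟩
    simp only [Set.mem_compl_iff, Set.mem_ofPred_eq, not_not]
    rw [← Matrix.exists_mulVec_eq_zero_iff]
    let u : U := ⟨M z, LinearMap.mem_range_self M z⟩
    refine ⟨B.repr u, ?_, ?_⟩
    · intro h
      apply hz
      have h2 : B.repr u = 0 := by ext i; simpa using congrFun h i
      have h3 : u = 0 := by simpa using h2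
      exact congrArg Subtype.val h3
    · ext i
      have hu : ∀ l, (M z) l = ∑ k, B.repr u k * (B k : Fin b → ℝ) l := by
        intro l
        have h1 : ((∑ k, B.repr u k • B k : U) : Fin b → ℝ) l = M z l := by
          rw [B.sum_repr u]
        rw [← h1, Submodule.coe_sum, Finset.sum_apply]
        rfl
      have h0 := hA (e i) (heI i)
      simp only [Matrix.mulVec, dotProduct, G, Matrix.of_apply, Pi.zero_apply]
      rw [← h0, mulVecFn]
      simp_rw [hu, Finset.mul_sum, Finset.sum_mul]
      rw [Finset.sum_comm]
      apply Finset.sum_congr rfl; intro _ _; apply Finset.sum_congr rfl; intro _ _; ring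
  refine measure_mono_null hsub ?_
  have hGc : Continuous fun A => (G A).det := by
    apply Continuous.matrix_det
    apply continuous_matrix
    intro i k
    simp only [G, Matrix.of_apply]
    fun_prop
  have hφ : ∀ k, ∃ φ : (Fin b → ℝ) →ₗ[ℝ] ℝ, φ.comp U.subtype = B.coord k := fun k =>
    LinearMap.exists_extend _
  choose φ hφ using hφ
  let A0 : Fin a → Fin b → ℝ := Function.extend e (fun k l => φ k (Pi.single l 1)) 0
  have hA0 : G A0 = 1 := by
    ext i k
    simp only [G, Matrix.of_apply, A0, heinj.extend_apply]
    have h1 : ∑ l, φ i (Pi.single l 1) * (B k : Fin b → ℝ) l = φ i (B k : Fin b → ℝ) := by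
      conv_rhs => rw [← Finset.univ_sum_single (B k : Fin b → ℝ), map_sum]
      apply Finset.sum_congr rfl
      intro l _
      have : (Pi.single l ((B k : Fin b → ℝ) l) : Fin b → ℝ) = (B k : Fin b → ℝ) l • Pi.single l 1 := by
        ext m; by_cases h : m = l
        · subst h; simp
        · simp [h]
      rw [this, map_smul, smul_eq_mul, mul_comm]
    rw [h1]
    have h2 := LinearMap.congr_fun (hφ i) (B k)
    simp only [LinearMap.comp_apply, Submodule.subtype_apply] at h2
    rw [h2]
    simp [Matrix.one_apply, Finsupp.single_apply, eq_comm]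
  have hlin : ∀ y (t : ℝ), G (y + t • A0) = G y + t • 1 := by
    intro y t
    rw [← hA0]
    ext i k
    simp only [G, Matrix.of_apply, Matrix.add_apply, Matrix.smul_apply, Pi.add_apply, Pi.smul_apply, smul_eq_mul,
      add_mul, Finset.sum_add_distrib, Finset.mul_sum, mul_assoc]
  have := ae_mem_of_ae_add_linearMap_mem (LinearMap.toSpanSingleton ℝ (Fin a → Fin b → ℝ) A0)
    (volume : Measure ℝ) (volume : Measure (Fin a → Fin b → ℝ)) (s := {A | (G A).det ≠ 0})
    (isOpen_ne_fun hGc continuous_const).measurableSet ?_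
  · exact this
  · intro y
    rw [ae_iff]
    apply Set.Finite.measure_zero
    refine ((-(G y)).charpoly.rootSet_finite ℝ).subset ?_
    intro t ht
    simp only [LinearMap.toSpanSingleton_apply, Set.mem_ofPred_eq, not_not, hlin] at ht
    rw [Polynomial.mem_rootSet]
    refine ⟨(Matrix.charpoly_monic _).ne_zero, ?_⟩
    rw [Polynomial.coe_aeval_eq_eval, Matrix.eval_charpoly, ← ht]
    congr 1
    ext i j
    by_cases h : i = j
    · subst h; simp [add_comm]
    · simp [h]

lemma sum_choose_le (n d : ℕ) : ∑ k ∈ Finset.Iic d, n.choose k ≤ (n + 1) ^ d := by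
  have h : Finset.Iic d = Finset.range (d + 1) := by ext; simp [Nat.lt_succ_iff]
  rw [h, add_pow]
  apply Finset.sum_le_sum
  intro k hk
  have hk' : k ≤ d := by simpa [Nat.lt_succ_iff] using hk
  calc n.choose k ≤ n ^ k := Nat.choose_le_pow _ _
    _ ≤ n ^ k * 1 ^ (d - k) * d.choose k := by
      rw [one_pow, mul_one]
      exact Nat.le_mul_of_pos_right _ (Nat.choose_pos hk')

lemma count_patterns {n d : ℕ} (φ : Fin n → ((Fin d → ℝ) →ₗ[ℝ] ℝ)) (Z : Set (Fin d → ℝ))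
    (hZ : ∀ z ∈ Z, ∀ I : Finset (Fin n), I.card = d → ¬ ∀ j ∈ I, φ j z = 0) :
    ∃ F : Finset (Fin n → Bool), F.card ≤ (n + 1) ^ d * (n + 1) ^ d ∧
      ∀ q z, z ∈ Z → (∀ j, q j = true → 0 ≤ φ j z) → (∀ j, q j = false → φ j z ≤ 0) → q ∈ F := by
  classical
  let 𝒜 : Finset (Finset (Fin n)) := Finset.univ.filter
    fun P => ∃ z, P = Finset.univ.filter fun j => 0 < φ j z
  let 𝒯 : Finset (Finset (Fin n)) := Finset.univ.filter fun T => T.card ≤ d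
  have h𝒯 : 𝒯.card ≤ (n + 1) ^ d := by
    refine le_trans ?_ (sum_choose_le n d)
    have : 𝒯 = (Finset.Iic d).biUnion fun k => Finset.powersetCard k Finset.univ := by
      ext T; simp [𝒯, Finset.mem_powersetCard]
    rw [this]
    refine Finset.card_biUnion_le.trans ?_
    simp
  have hvc : 𝒜.vcDim ≤ d := by
    unfold Finset.vcDim
    apply Finset.sup_le
    intro I hI
    rw [Finset.mem_shatterer] at hI
    have hli : LinearIndependent ℝ (fun j : I => φ j) := by
      rw [Fintype.linearIndependent_iff]
      by_contra hne
      push Not at hne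
      obtain ⟨c, hc, j0, hj0⟩ := hne
      have : ∃ c : I → ℝ, ∑ i, c i • φ i = 0 ∧ ∃ i, 0 < c i := by
        rcases lt_or_gt_of_ne hj0 with h | h
        · refine ⟨fun i => - c i, ?_, j0, by simpa using h⟩
          have h5 : ∑ i : I, (-c i) • φ i = -∑ i : I, c i • φ i := by
            rw [← Finset.sum_neg_distrib]; 
            refine Finset.sum_congr rfl fun i _ => ?_
            apply LinearMap.ext
            intro z
            simp only [LinearMap.smul_apply, LinearMap.neg_apply, smul_eq_mul, neg_mul]
          rw [h5, hc, neg_zero]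
        · exact ⟨c, hc, j0, h⟩
      obtain ⟨c, hc, j0, hj0⟩ := this
      obtain ⟨P, hP, hPI⟩ := hI (t := (Finset.univ.filter fun i : I => 0 < c i).image Subtype.val) (by
        intro x hx; simp at hx; obtain ⟨h, _⟩ := hx; exact h)
      simp only [𝒜, Finset.mem_filter, Finset.mem_univ, true_and] at hP
      obtain ⟨z, rfl⟩ := hP
      have hiff : ∀ i : I, 0 < φ i z ↔ 0 < c i := by
        intro i
        have := congrArg (fun s => (i : Fin n) ∈ s) hPI
        simpa using this
      have hz := LinearMap.congr_fun hc z
      simp only [LinearMap.sum_apply, LinearMap.smul_apply, smul_eq_mul, LinearMap.zero_apply] at hz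
      have hpos : 0 < ∑ i : I, c i * φ i z := by
        apply Finset.sum_pos'
        · intro i _
          by_cases h : 0 < c i
          · exact mul_nonneg h.le ((hiff i).2 h).le
          · have h2 : ¬ 0 < φ i z := fun h3 => h ((hiff i).1 h3)
            exact mul_nonneg_of_nonpos_of_nonpos (not_lt.1 h) (not_lt.1 h2)
        · exact ⟨j0, Finset.mem_univ _, mul_pos hj0 ((hiff j0).2 hj0)⟩
      exact hpos.ne' hz
    have := hli.fintype_card_le_finrank
    have h2 : Module.finrank ℝ ((Fin d → ℝ) →ₗ[ℝ] ℝ) = d := by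
      have := Subspace.dual_finrank_eq (K := ℝ) (V := Fin d → ℝ)
      simpa [Module.Dual] using this
    rw [h2] at this
    simpa using this
  have h𝒜 : 𝒜.card ≤ (n + 1) ^ d := by
    refine (Finset.card_le_card_shatterer 𝒜).trans (Finset.card_shatterer_le_sum_vcDim.trans ?_)
    rw [Fintype.card_fin]
    refine le_trans ?_ (sum_choose_le n d)
    exact Finset.sum_le_sum_of_subset (Finset.Iic_subset_Iic.2 hvc)
  refine ⟨(𝒜 ×ˢ 𝒯).image fun PT => fun j => decide (j ∈ PT.1 ∪ PT.2), ?_, ?_⟩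
  · refine Finset.card_image_le.trans ?_
    rw [Finset.card_product]
    exact Nat.mul_le_mul h𝒜 h𝒯
  · intro q z hz h1 h2
    rw [Finset.mem_image]
    refine ⟨(Finset.univ.filter fun j => 0 < φ j z, Finset.univ.filter fun j => φ j z = 0 ∧ q j = true), ?_, ?_⟩
    · rw [Finset.mem_product]
      refine ⟨?_, ?_⟩
      · simp only [𝒜, Finset.mem_filter, Finset.mem_univ, true_and]
        exact ⟨z, rfl⟩
      · simp only [𝒯, Finset.mem_filter, Finset.mem_univ, true_and]
        by_contra hcard
        push Not at hcard
        obtain ⟨I, hIs, hIc⟩ := Finset.exists_subset_card_eq hcard.le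
        apply hZ z hz I hIc
        intro j hj
        have := hIs hj
        simp at this
        exact this.1
    · ext j
      simp only [Finset.mem_union, Finset.mem_filter, Finset.mem_univ, true_and]
      cases hq : q j
      · have := h2 j hq
        simp [this]
      · have := h1 j hq
        rcases this.lt_or_eq with h | h
        · simp [h]
        · simp [← h]

lemma norm_toLp_sq {n : ℕ} (v : Fin n → ℝ) : ‖(WithLp.toLp 2 v : EuclideanSpace ℝ (Fin n))‖ ^ 2 = nsq v := by
  rw [EuclideanSpace.norm_sq_eq]; simp [nsq]

lemma exists_net (d : ℕ) : ∃ F : Finset (Fin d → ℝ), F.card ≤ 5 ^ d ∧ (∀ v ∈ F, nsq v ≤ 1) ∧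
    ∀ (m : ℕ) (T : (Fin d → ℝ) →ₗ[ℝ] (Fin m → ℝ)) (B : ℝ), 0 ≤ B →
      (∀ v ∈ F, nsq (T v) ≤ B) → ∀ v, nsq (T v) ≤ 4 * B * nsq v := by
  classical
  let E := EuclideanSpace ℝ (Fin d)
  let P : Finset E → Prop := fun s => (∀ c ∈ s, ‖c‖ ≤ 2) ∧ ∀ c ∈ s, ∀ d ∈ s, c ≠ d → 1 ≤ ‖c - d‖
  have hcard : ∀ s, P s → s.card ≤ 5 ^ d := by
    intro s hs
    have := Besicovitch.card_le_of_separated s hs.1 hs.2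
    simpa [E] using this
  obtain ⟨s, hs, hmax⟩ : ∃ s, P s ∧ ∀ s', P s' → s'.card ≤ s.card := by
    have hne : {k | ∃ s, P s ∧ s.card = k}.Nonempty := ⟨0, ∅, ⟨by simp, by simp⟩, rfl⟩
    have hb : BddAbove {k | ∃ s, P s ∧ s.card = k} := ⟨5 ^ d, by rintro k ⟨s, h, rfl⟩; exact hcard s h⟩
    obtain ⟨s, h1, h2⟩ := Nat.sSup_mem hne hb
    exact ⟨s, h1, fun s' h' => by rw [h2]; exact le_csSup hb ⟨s', h', rfl⟩⟩
  have hnet : ∀ x : E, ‖x‖ ≤ 2 → ∃ c ∈ s, ‖x - c‖ ≤ 1 := by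
    intro x hx
    by_contra hcon
    push Not at hcon
    have hxs : x ∉ s := by
      intro h; have := hcon x h; simp at this; linarith
    have hP : P (insert x s) := by
      refine ⟨?_, ?_⟩
      · intro c hc
        rcases Finset.mem_insert.1 hc with rfl | h
        · exact hx
        · exact hs.1 c h
      · intro c hc e he hce
        rcases Finset.mem_insert.1 hc with rfl | h <;> rcases Finset.mem_insert.1 he with rfl | h'
        · exact absurd rfl hce
        · exact (hcon e h').le
        · rw [norm_sub_rev]; exact (hcon c h).le
        · exact hs.2 c h e h' hce
    have := hmax _ hP
    rw [Finset.card_insert_of_notMem hxs] at this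
    omega
  refine ⟨s.image fun c => (1/2 : ℝ) • WithLp.ofLp c, Finset.card_image_le.trans (hcard s hs), ?_, ?_⟩
  · intro v hv
    obtain ⟨c, hc, rfl⟩ := Finset.mem_image.1 hv
    rw [← norm_toLp_sq, WithLp.toLp_smul, norm_smul]
    have := hs.1 c hc
    have h0 := norm_nonneg c
    simp only [WithLp.toLp_ofLp, mul_pow]
    norm_num
    nlinarith
  · intro m T B hB hT v
    let T' : E →L[ℝ] EuclideanSpace ℝ (Fin m) := LinearMap.toContinuousLinearMap
      (((WithLp.linearEquiv 2 ℝ (Fin m → ℝ)).symm.toLinearMap.comp T).comp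
        (WithLp.linearEquiv 2 ℝ (Fin d → ℝ)).toLinearMap)
    have hT' : ∀ x : E, T' x = WithLp.toLp 2 (T (WithLp.ofLp x)) := fun x => rfl
    have hsmall : ∀ c ∈ s, ‖T' c‖ ≤ 2 * Real.sqrt B := by
      intro c hc
      have h1 := hT _ (Finset.mem_image_of_mem _ hc)
      rw [← norm_toLp_sq, map_smul, WithLp.toLp_smul, ← hT', norm_smul, mul_pow] at h1
      have h2 : ‖T' c‖ ^ 2 ≤ (2 * Real.sqrt B) ^ 2 := by
        rw [mul_pow, Real.sq_sqrt hB]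
        norm_num at h1 ⊢
        linarith
      exact le_of_sq_le_sq h2 (by positivity)
    have hN : ‖T'‖ ≤ Real.sqrt B + ‖T'‖ / 2 := by
      apply ContinuousLinearMap.opNorm_le_bound _ (by positivity)
      intro x
      by_cases hx : x = 0
      · subst hx; simp
      have hxn : 0 < ‖x‖ := norm_pos_iff.2 hx
      let y : E := (2 / ‖x‖) • x
      have hy : ‖y‖ = 2 := by
        simp only [y, norm_smul]
        rw [Real.norm_of_nonneg (by positivity : 0 ≤ 2 / ‖x‖)]
        field_simp
      obtain ⟨c, hc, hcy⟩ := hnet y hy.le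
      have h1 : ‖T' y‖ ≤ 2 * Real.sqrt B + ‖T'‖ * 1 := by
        have : T' y = T' c + T' (y - c) := by rw [← map_add]; congr 1; abel
        rw [this]
        refine (norm_add_le _ _).trans (add_le_add (hsmall c hc) ?_)
        refine (T'.le_opNorm _).trans ?_
        gcongr
      have h2 : ‖T' y‖ = 2 / ‖x‖ * ‖T' x‖ := by
        simp only [y, map_smul, norm_smul]
        rw [Real.norm_of_nonneg (by positivity : 0 ≤ 2 / ‖x‖)]
      rw [h2, div_mul_eq_mul_div, div_le_iff₀ hxn] at h1
      linarith
    have hN2 : ‖T'‖ ≤ 2 * Real.sqrt B := by linarith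
    have h3 : ‖T' (WithLp.toLp 2 v)‖ ≤ 2 * Real.sqrt B * ‖(WithLp.toLp 2 v : E)‖ :=
      (T'.le_opNorm (WithLp.toLp 2 v)).trans (mul_le_mul_of_nonneg_right hN2 (norm_nonneg _))
    have h4 : ‖T' (WithLp.toLp 2 v)‖ ^ 2 ≤ (2 * Real.sqrt B * ‖(WithLp.toLp 2 v : E)‖) ^ 2 := by
      gcongr
    rw [hT', norm_toLp_sq, mul_pow, mul_pow, Real.sq_sqrt hB, norm_toLp_sq] at h4
    simp only [WithLp.ofLp_toLp] at h4
    norm_num at h4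
    linarith


/-- All weights. -/
abbrev Wts (D : ℕ → ℕ) := ∀ i : ℕ, Fin (D (i+1)) → Fin (D i) → ℝ
/-- All activation patterns. -/
abbrev Pat (D : ℕ → ℕ) := ∀ i : ℕ, Fin (D (i+1)) → Bool

/-- masked chain product started at layer `s`. -/
def pr (D : ℕ → ℕ) (W : Wts D) (p : Pat D) (s : ℕ) (v : Fin (D s) → ℝ) :
    (n : ℕ) → Fin (D (s + n)) → ℝ
  | 0 => v
  | (n+1) => fun a => if p (s+n) a = true then mulVecFn (W (s+n)) (pr D W p s v n) a else 0

lemma mulVecFn_add {a b : ℕ} (M : Fin a → Fin b → ℝ) (u v : Fin b → ℝ) :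
    mulVecFn M (u + v) = mulVecFn M u + mulVecFn M v := by
  ext j; simp [mulVecFn, mul_add, Finset.sum_add_distrib]

lemma mulVecFn_smul {a b : ℕ} (M : Fin a → Fin b → ℝ) (c : ℝ) (v : Fin b → ℝ) :
    mulVecFn M (c • v) = c • mulVecFn M v := by
  ext j; simp only [mulVecFn, Pi.smul_apply, smul_eq_mul, Finset.mul_sum]
  exact Finset.sum_congr rfl fun _ _ => by ring

lemma pr_add (D : ℕ → ℕ) (W : Wts D) (p : Pat D) (s : ℕ) (u v : Fin (D s) → ℝ) (n : ℕ) :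
    pr D W p s (u + v) n = pr D W p s u n + pr D W p s v n := by
  induction n with
  | zero => rfl
  | succ n ih =>
    ext a
    simp only [pr, ih, mulVecFn_add, Pi.add_apply]
    split_ifs <;> simp

lemma pr_smul (D : ℕ → ℕ) (W : Wts D) (p : Pat D) (s : ℕ) (c : ℝ) (v : Fin (D s) → ℝ) (n : ℕ) :
    pr D W p s (c • v) n = c • pr D W p s v n := by
  induction n with
  | zero => rfl
  | succ n ih =>
    ext a
    simp only [pr, ih, mulVecFn_smul, Pi.smul_apply]
    split_ifs <;> simp

/-- `pr` as a linear map. -/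
def prL (D : ℕ → ℕ) (W : Wts D) (p : Pat D) (s n : ℕ) :
    (Fin (D s) → ℝ) →ₗ[ℝ] (Fin (D (s + n)) → ℝ) where
  toFun v := pr D W p s v n
  map_add' u v := pr_add D W p s u v n
  map_smul' c v := pr_smul D W p s c v n

/-- weak compatibility of a boolean mask with a real vector -/
def compat {n : ℕ} (q : Fin n → Bool) (g : Fin n → ℝ) : Prop :=
  ∀ a, (q a = true → 0 ≤ g a) ∧ (q a = false → g a ≤ 0)

/-- The state `z` at layer `s` reaches layer `s+n` through pattern `p`. -/
def Reach (D : ℕ → ℕ) (W : Wts D) (p : Pat D) (s n : ℕ) (z : Fin (D s) → ℝ) : Prop :=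
  ∀ t < n, pr D W p s z t ≠ 0 ∧ compat (p (s+t)) (mulVecFn (W (s+t)) (pr D W p s z t))

/-- the net of the unit ball -/
def net (d : ℕ) : Finset (Fin d → ℝ) := (exists_net d).choose

lemma net_card (d : ℕ) : (net d).card ≤ 5 ^ d := (exists_net d).choose_spec.1
lemma net_norm (d : ℕ) : ∀ v ∈ net d, nsq v ≤ 1 := (exists_net d).choose_spec.2.1
lemma net_ext (d : ℕ) : ∀ (m : ℕ) (T : (Fin d → ℝ) →ₗ[ℝ] (Fin m → ℝ)) (B : ℝ), 0 ≤ B →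
      (∀ v ∈ net d, nsq (T v) ≤ B) → ∀ v, nsq (T v) ≤ 4 * B * nsq v :=
  (exists_net d).choose_spec.2.2

/-- one-step failure for the net vectors -/
def StepBad (D : ℕ → ℕ) (c : ℝ) (W : Wts D) (p : Pat D) (s n : ℕ) : Prop :=
  ∃ v ∈ net (D s), c * (max (D (s+n+1)) (D s) : ℕ) * (1 / (D (s+n) : ℝ)) * nsq (pr D W p s v n)
    < nsq (mulVecFn (W (s+n)) (pr D W p s v n))

/-- failure event -/
def Bad (D : ℕ → ℕ) (c : ℝ) (W : Wts D) (s n : ℕ) : Prop :=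
  ∃ p z, Reach D W p s n z ∧ StepBad D c W p s n

lemma Reach.mono {D : ℕ → ℕ} {W : Wts D} {p : Pat D} {s n m : ℕ} {z : Fin (D s) → ℝ}
    (h : Reach D W p s n z) (hm : m ≤ n) : Reach D W p s m z :=
  fun t ht => h t (ht.trans_le hm)

lemma nsq_mask {n : ℕ} (q : Fin n → Bool) (g : Fin n → ℝ) :
    nsq (fun a => if q a = true then g a else 0) ≤ nsq g := by
  unfold nsq
  apply Finset.sum_le_sum
  intro a _
  dsimp only
  split_ifs
  · exact le_rfl
  · simp; positivity

lemma seg_bound {D : ℕ → ℕ} {c : ℝ} (hc : 1 ≤ c) {W : Wts D} {p : Pat D} {s n : ℕ}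
    {z : Fin (D s) → ℝ} (hD : 0 < D s) (hle : ∀ t ≤ n, D s ≤ D (s + t))
    (hbad : ∀ t ≤ n, ¬ Bad D c W s t) (hR : Reach D W p s n z) (v : Fin (D s) → ℝ) :
    nsq (pr D W p s v (n+1)) ≤ (4*c)^(n+1) * ((max (D (s+n+1)) (D s) : ℕ) / (D s : ℝ)) * nsq v := by
  have hDs : (0:ℝ) < D s := by exact_mod_cast hD
  have key : ∀ t ≤ n + 1, ∀ v ∈ net (D s),
      nsq (pr D W p s v t) ≤ c ^ t * ((max (D (s+t)) (D s) : ℕ) / (D s : ℝ)) := by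
    intro t
    induction t with
    | zero =>
      intro _ v hv
      simp only [pr, pow_zero, add_zero, max_self, one_mul, div_self hDs.ne']
      exact net_norm _ v hv
    | succ t ih =>
      intro ht v hv
      have ih := ih (by omega) v hv
      have h1 : nsq (pr D W p s v (t+1)) ≤ nsq (mulVecFn (W (s+t)) (pr D W p s v t)) :=
        nsq_mask _ _
      have h2 : nsq (mulVecFn (W (s+t)) (pr D W p s v t)) ≤
          c * (max (D (s+t+1)) (D s) : ℕ) * (1 / (D (s+t) : ℝ)) * nsq (pr D W p s v t) := by
        by_contra hcon
        push Not at hcon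
        exact hbad t (by omega) ⟨p, z, hR.mono (by omega), v, hv, hcon⟩
      have hDt : D s ≤ D (s+t) := hle t (by omega)
      have hDt' : (0:ℝ) < D (s+t) := by exact_mod_cast hD.trans_le hDt
      rw [max_eq_left hDt] at ih
      refine h1.trans (h2.trans ?_)
      calc _ ≤ c * (max (D (s+t+1)) (D s) : ℕ) * (1 / (D (s+t) : ℝ)) * (c ^ t * ((D (s+t) : ℕ) / (D s : ℝ))) := by
            gcongr
        _ = _ := by
            rw [← add_assoc, pow_succ]
            field_simp
  have := net_ext (D s) _ (prL D W p s (n+1)) (c ^ (n+1) * ((max (D (s+(n+1))) (D s) : ℕ) / (D s : ℝ)))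
    (by positivity) (key (n+1) le_rfl) v
  refine this.trans ?_
  rw [mul_pow, ← add_assoc]
  have h4 : (4:ℝ) ≤ 4 ^ (n+1) := by
    calc (4:ℝ) = 4 ^ 1 := by norm_num
      _ ≤ _ := pow_le_pow_right₀ (by norm_num) (by omega)
  have hn := nsq_nonneg v
  rw [mul_assoc (4 ^ (n+1) : ℝ)]
  gcongr

lemma argminLt_spec (D : ℕ → ℕ) (k : ℕ) (hk : 0 < k) :
    argminLt D k < k ∧ ∀ j, j < k → D (argminLt D k) ≤ D j := by
  have hne : {i | i < k ∧ ∀ j, j < k → D i ≤ D j}.Nonempty := by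
    obtain ⟨i, hi, hmin⟩ := Finset.exists_min_image (Finset.range k) D ⟨0, by simpa using hk⟩
    exact ⟨i, by simpa using hi, fun j hj => hmin j (by simpa using hj)⟩
  exact Nat.sInf_mem hne

lemma argminLt_lt (D : ℕ → ℕ) (k i : ℕ) (hi : i < argminLt D k) : D (argminLt D k) < D i := by
  have hk : 0 < k := by
    rcases Nat.eq_zero_or_pos k with rfl | h
    · simp [argminLt] at hi
    · exact h
  obtain ⟨h1, h2⟩ := argminLt_spec D k hk
  by_contra hcon
  push Not at hcon
  have : i ∈ {i | i < k ∧ ∀ j, j < k → D i ≤ D j} := ⟨hi.trans h1, fun j hj => hcon.trans (h2 j hj)⟩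
  exact absurd (Nat.sInf_le this) (not_le.2 hi)

lemma bn_le (D : ℕ → ℕ) (ℓ j : ℕ) (hj : 1 ≤ j) : bn D ℓ j ≤ ℓ := by
  induction j with
  | zero => omega
  | succ j ih =>
    rcases Nat.eq_zero_or_pos j with rfl | h
    · have := (argminLt_spec D (ℓ+1) (by omega)).1
      simp only [bn]; omega
    · have ih := ih h
      rcases Nat.eq_zero_or_pos (bn D ℓ j) with h0 | h0
      · simp [bn, h0, argminLt]
      · have := (argminLt_spec D _ h0).1
        simp only [bn]; omega

/-- chain condition -/
def NetChain (D : ℕ → ℕ) (W : Wts D) (p : Pat D) (k : ℕ) (u : ∀ i, Fin (D i) → ℝ) : Prop :=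
  ∀ i < k, u (i+1) = fun a => if p i a = true then mulVecFn (W i) (u i) a else 0

lemma NetChain.eq_pr {D : ℕ → ℕ} {W : Wts D} {p : Pat D} {k : ℕ} {u : ∀ i, Fin (D i) → ℝ}
    (h : NetChain D W p k u) (s n : ℕ) (hn : s + n ≤ k) : u (s+n) = pr D W p s (u s) n := by
  induction n with
  | zero => rfl
  | succ n ih =>
    have := h (s+n) (by omega)
    refine this.trans ?_
    rw [ih (by omega)]
    rfl

lemma forward_chain {D : ℕ → ℕ} {W : Wts D} {p : Pat D} {k : ℕ} {y : Fin (D 0) → ℝ}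
    (h : ∀ i < k, compat (p i) (preact D W i y)) : NetChain D W p k (fun i => forward D W i y) := by
  intro i hi
  ext a
  have := h i hi a
  simp only [forward]
  change max (preact D W i y a) 0 = if p i a = true then preact D W i y a else 0
  cases hp : p i a
  · simp [this.2 hp]
  · simp [this.1 hp]

lemma forward_reach {D : ℕ → ℕ} {W : Wts D} {p : Pat D} {y : Fin (D 0) → ℝ} (s n : ℕ)
    (h : ∀ i < s + n, compat (p i) (preact D W i y)) (hne : ∀ i < s + n, forward D W i y ≠ 0) :
    Reach D W p s n (forward D W s y) := by
  intro t ht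
  have := (forward_chain h).eq_pr s t (by omega)
  rw [← this]
  exact ⟨hne _ (by omega), h _ (by omega)⟩

lemma chain_seg {ℓ : ℕ} {D : ℕ → ℕ} {c : ℝ} (hc : 1 ≤ c) {W : Wts D}
    (hA : ∀ s n, s + n < ℓ → ¬ Bad D c W s n) {k : ℕ} (hk0 : 0 < k) (hk : k ≤ ℓ) 
    (hDpos : 0 < D (argminLt D k))
    {y : Fin (D 0) → ℝ} {p : Pat D} (hp : ∀ i < k, compat (p i) (preact D W i y))
    (hne : ∀ i, i + 1 < k → forward D W i y ≠ 0) {u : ∀ i, Fin (D i) → ℝ}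
    (hu : ∀ i, argminLt D k ≤ i → i < k → u (i+1) = fun a => if p i a = true then mulVecFn (W i) (u i) a else 0) :
    nsq (u k) ≤ (4*c)^(k - argminLt D k) *
      ((max (D k) (D (argminLt D k)) : ℕ) / (D (argminLt D k) : ℝ)) * nsq (u (argminLt D k)) := by
  obtain ⟨h1, h2⟩ := argminLt_spec D k hk0
  generalize argminLt D k = s at *
  obtain ⟨n, rfl⟩ : ∃ n, k = s + (n + 1) := ⟨k - s - 1, by omega⟩
  have hR : Reach D W p s n (forward D W s y) :=
    forward_reach s n (fun i hi => hp i (by omega)) (fun i hi => hne i (by omega))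
  have hpr : ∀ m ≤ n + 1, u (s+m) = pr D W p s (u s) m := by
    intro m
    induction m with
    | zero => intro _; rfl
    | succ m ih =>
      intro hm
      have := hu (s+m) (by omega) (by omega)
      refine this.trans ?_
      rw [ih (by omega)]
      rfl
  rw [hpr (n+1) le_rfl, Nat.add_sub_cancel_left]
  exact seg_bound hc hDpos (fun t ht => h2 _ (by omega)) (fun t ht => hA s t (by omega)) hR (u s)

lemma chain_bound {ℓ : ℕ} {D : ℕ → ℕ} {c : ℝ} (hc : 1 ≤ c) {W : Wts D} (hD : ∀ i ≤ ℓ, 0 < D i)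
    (hA : ∀ s n, s + n < ℓ → ¬ Bad D c W s n) : ∀ (k : ℕ) (_ : k ≤ ℓ) 
    (y : Fin (D 0) → ℝ) (p : Pat D) (_ : ∀ i < k, compat (p i) (preact D W i y))
    (_ : ∀ i, i + 1 < k → forward D W i y ≠ 0) (u : ∀ i, Fin (D i) → ℝ) (_ : NetChain D W p k u),
    ∃ j ≤ k, nsq (u k) ≤ (4*c)^k * (D k / D j) * nsq (u 0) := by
  intro k
  induction k using Nat.strong_induction_on with
  | _ k ih =>
  intro hk y p hp hne u hu
  rcases Nat.eq_zero_or_pos k with rfl | hk0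
  · refine ⟨0, le_rfl, ?_⟩
    have : (0:ℝ) < D 0 := by exact_mod_cast hD 0 (by omega)
    simp [div_self this.ne']
  obtain ⟨h1, h2⟩ := argminLt_spec D k hk0
  have hs := chain_seg hc hA hk0 hk (hD _ (by omega)) hp hne (fun i _ hi => hu i hi)
  set s := argminLt D k
  obtain ⟨j, hj, hjb⟩ := ih s h1 (by omega) y p (fun i hi => hp i (by omega))
    (fun i hi => hne i (by omega)) u (fun i hi => hu i (by omega))
  have hDs : (0:ℝ) < D s := by exact_mod_cast hD s (by omega)
  have hDk : (0:ℝ) < D k := by exact_mod_cast hD k (by omega)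
  have hDj : (0:ℝ) < D j := by exact_mod_cast hD j (by omega)
  have hsj : (D s : ℝ) / D j ≤ 1 := by
    rw [div_le_one hDj]; exact_mod_cast h2 j (by omega)
  have h0 := nsq_nonneg (u 0)
  have h3 : nsq (u s) ≤ (4*c)^s * nsq (u 0) := by
    refine hjb.trans ?_
    calc _ ≤ (4*c)^s * 1 * nsq (u 0) := by gcongr
      _ = _ := by ring
  have h4 : nsq (u k) ≤ (4*c)^k * ((max (D k) (D s) : ℕ) / (D s : ℝ)) * nsq (u 0) := by
    calc nsq (u k) ≤ _ := hs
      _ ≤ (4*c)^(k-s) * ((max (D k) (D s) : ℕ) / (D s : ℝ)) * ((4*c)^s * nsq (u 0)) := by gcongr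
      _ = (4*c)^(k-s+s) * ((max (D k) (D s) : ℕ) / (D s : ℝ)) * nsq (u 0) := by rw [pow_add]; ring
      _ = _ := by rw [Nat.sub_add_cancel h1.le]
  rcases le_total (D s) (D k) with h | h
  · refine ⟨s, h1.le, ?_⟩
    rwa [max_eq_left h] at h4
  · refine ⟨k, le_rfl, ?_⟩
    rw [max_eq_right h, div_self hDs.ne'] at h4
    rwa [div_self hDk.ne']

/-- directional derivative chain -/
def dfw (D : ℕ → ℕ) (W : Wts D) (y v : Fin (D 0) → ℝ) : (i : ℕ) → Fin (D i) → ℝ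
  | 0 => v
  | (i+1) => fun a => if 0 < preact D W i y a ∨ (preact D W i y a = 0 ∧ 0 < mulVecFn (W i) (dfw D W y v i) a)
      then mulVecFn (W i) (dfw D W y v i) a else 0

lemma relu_right_deriv {g : ℝ → ℝ} {g' t : ℝ} (h : HasDerivWithinAt g g' (Set.Ici t) t) :
    HasDerivWithinAt (fun s => max (g s) 0) (if 0 < g t ∨ (g t = 0 ∧ 0 < g') then g' else 0) (Set.Ici t) t := by
  rcases lt_trichotomy (g t) 0 with h0 | h0 | h0
  · rw [if_neg (by intro h1; rcases h1 with h1 | h1 <;> linarith [h1])]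
    have hev : ∀ᶠ s in nhdsWithin t (Set.Ici t), g s < 0 :=
      h.continuousWithinAt.eventually_lt continuousWithinAt_const h0
    refine (hasDerivWithinAt_const t (Set.Ici t) (0:ℝ)).congr_of_eventuallyEq ?_ (max_eq_right h0.le)
    filter_upwards [hev] with s hs
    exact max_eq_right hs.le
  · have hval : (if 0 < g t ∨ (g t = 0 ∧ 0 < g') then g' else 0) = max g' 0 := by
      by_cases h1 : 0 < g'
      · rw [if_pos (Or.inr ⟨h0, h1⟩), max_eq_left h1.le]
      · rw [if_neg (by rw [h0]; simp [h1]), max_eq_right (not_lt.1 h1)]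
    rw [hval]
    rw [hasDerivWithinAt_iff_isLittleO] at h ⊢
    refine Asymptotics.IsBigO.trans_isLittleO (Asymptotics.IsBigO.of_bound' ?_) h
    filter_upwards [self_mem_nhdsWithin] with s hs
    have hs' : 0 ≤ s - t := sub_nonneg.2 hs
    have h1 : (s - t) • max g' 0 = max ((s-t) * g') 0 := by
      rw [smul_eq_mul, mul_max_of_nonneg _ _ hs', mul_zero]
    rw [h1, h0, smul_eq_mul]
    simp only [max_self, sub_zero, Real.norm_eq_abs]
    exact abs_max_sub_max_le_abs _ _ _
  · rw [if_pos (Or.inl h0)]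
    have hev : ∀ᶠ s in nhdsWithin t (Set.Ici t), 0 < g s :=
      continuousWithinAt_const.eventually_lt h.continuousWithinAt h0
    refine h.congr_of_eventuallyEq ?_ (max_eq_left h0.le)
    filter_upwards [hev] with s hs
    exact max_eq_left hs.le


lemma forward_right_deriv (D : ℕ → ℕ) (W : Wts D) (x v : Fin (D 0) → ℝ) (t : ℝ) (i : ℕ) :
    ∀ a, HasDerivWithinAt (fun s : ℝ => forward D W i (x + s • v) a) (dfw D W (x + t • v) v i a)
      (Set.Ici t) t := by
  induction i with
  | zero =>
    intro a
    simp only [forward, dfw, Pi.add_apply, Pi.smul_apply, smul_eq_mul]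
    have := ((hasDerivAt_id t).mul_const (v a)).const_add (x a)
    simpa using this.hasDerivWithinAt
  | succ i ih =>
    intro a
    have h : HasDerivWithinAt (fun s : ℝ => preact D W i (x + s • v) a)
        (mulVecFn (W i) (dfw D W (x + t • v) v i) a) (Set.Ici t) t := by
      unfold preact mulVecFn
      exact HasDerivWithinAt.fun_sum fun k _ => (ih k).const_mul _
    exact relu_right_deriv h

lemma continuous_forward (D : ℕ → ℕ) (W : Wts D) (i : ℕ) : Continuous (forward D W i) := by
  induction i with
  | zero => exact continuous_id
  | succ i ih =>
    apply continuous_pi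
    intro a
    simp only [forward]
    have : ∀ k, Continuous fun x => forward D W i x k := fun k => (continuous_apply k).comp ih
    fun_prop

lemma forward_lip (D : ℕ → ℕ) (W : Wts D) (x v : Fin (D 0) → ℝ) (i : ℕ) (B : ℝ)
    (hb : ∀ t ∈ Set.Ico (0:ℝ) 1, nsq (dfw D W (x + t • v) v i) ≤ B) :
    nsq (fun a => forward D W i (x + v) a - forward D W i x a) ≤ B := by
  have hB : 0 ≤ B := (nsq_nonneg _).trans (hb 0 (by simp))
  let f : ℝ → EuclideanSpace ℝ (Fin (D i)) := fun t => WithLp.toLp 2 (forward D W i (x + t • v))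
  have hfc : Continuous f := by
    have h1 := continuous_forward D W i
    have h2 : Continuous fun t : ℝ => forward D W i (x + t • v) := h1.comp (by fun_prop)
    exact (PiLp.continuous_toLp 2 _).comp h2
  have := norm_image_sub_le_of_norm_deriv_right_le_segment (f := f) (a := 0) (b := 1)
    (f' := fun t => WithLp.toLp 2 (dfw D W (x + t • v) v i)) (C := Real.sqrt B) hfc.continuousOn ?_ ?_ 1 (by simp)
  · have h2 : ‖f 1 - f 0‖ ^ 2 ≤ (Real.sqrt B * (1 - 0)) ^ 2 := by gcongr
    rw [sub_zero, mul_one, Real.sq_sqrt hB] at h2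
    simp only [f, one_smul, zero_smul, add_zero] at h2
    rw [← WithLp.toLp_sub, norm_toLp_sq] at h2
    exact h2
  · intro t _
    have h1 : HasDerivWithinAt (fun s : ℝ => forward D W i (x + s • v)) (dfw D W (x + t • v) v i)
        (Set.Ici t) t := hasDerivWithinAt_pi.2 (forward_right_deriv D W x v t i)
    exact ((PiLp.continuousLinearEquiv 2 ℝ (fun _ : Fin (D i) => ℝ)).symm.hasFDerivAt
      (x := forward D W i (x + t • v))).comp_hasDerivWithinAt t h1
  · intro t ht
    apply Real.le_sqrt_of_sq_le
    rw [norm_toLp_sq]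
    exact hb t ht

lemma dfw_chain (D : ℕ → ℕ) (W : Wts D) (y v : Fin (D 0) → ℝ) : ∃ p : Pat D,
    (∀ i, compat (p i) (preact D W i y)) ∧ ∀ k, NetChain D W p k (dfw D W y v) := by
  refine ⟨fun i a => decide (0 < preact D W i y a ∨ (preact D W i y a = 0 ∧ 0 < mulVecFn (W i) (dfw D W y v i) a)), ?_, ?_⟩
  · intro i a
    simp only [decide_eq_true_eq, decide_eq_false_iff_not]
    refine ⟨?_, ?_⟩
    · rintro (h | h)
      · exact h.le
      · exact h.1.ge
    · intro h
      push Not at h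
      exact h.1
  · intro k i _
    ext a
    simp only [decide_eq_true_eq]
    rfl

lemma nsq_smul {n : ℕ} (c : ℝ) (v : Fin n → ℝ) : nsq (c • v) = c ^ 2 * nsq v := by
  simp [nsq, mul_pow, Finset.mul_sum]

lemma nonvanish {ℓ : ℕ} {D : ℕ → ℕ} {c : ℝ} (hc : 1 ≤ c) {W : Wts D} (hD : ∀ i ≤ ℓ, 0 < D i)
    (hA : ∀ s n, s + n < ℓ → ¬ Bad D c W s n) (x : Fin (D 0) → ℝ)
    (hx : ∀ k, k ≤ ℓ → (1/40:ℝ)^k * D k ≤ nsq (forward D W k x)) (R2 : ℝ)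
    (hR : ∀ k, k + 1 < ℓ → ∀ j ≤ ℓ, R2 * (160 * c) ^ k < D j) :
    ∀ k, k + 1 < ℓ → ∀ y, nsq (fun m => y m - x m) ≤ R2 → forward D W k y ≠ 0 := by
  intro k
  induction k using Nat.strong_induction_on with
  | _ k ih =>
  intro hk y hy h0
  obtain ⟨v, rfl⟩ : ∃ v, y = x + v := ⟨y - x, by simp⟩
  have hv : nsq v ≤ R2 := by simpa using hy
  have hDk : (0:ℝ) < D k := by exact_mod_cast hD k (by omega)
  obtain ⟨jm, hjm, hjmin⟩ := Finset.exists_min_image (Finset.range (ℓ+1)) D ⟨0, by simp⟩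
  have hjm' : jm ≤ ℓ := by simpa [Nat.lt_succ_iff] using hjm
  have hDj : (0:ℝ) < D jm := by exact_mod_cast hD jm hjm'
  have hlip := forward_lip D W x v k ((4*c)^k * (D k / D jm) * R2) ?_
  · rw [h0] at hlip
    have h1 : nsq (fun a => (0 : Fin (D k) → ℝ) a - forward D W k x a) = nsq (forward D W k x) := by
      simp [nsq]
    rw [h1] at hlip
    have h2 := (hx k (by omega)).trans hlip
    have h3 := hR k hk jm hjm'
    have h4 : (4*c)^k * (D k / D jm) * R2 < (1/40:ℝ)^k * D k := by
      have e : (4*c)^k = (1/40:ℝ)^k * (160*c)^k := by rw [← mul_pow]; congr 1; ring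
      rw [e]
      calc (1/40:ℝ)^k * (160*c)^k * (D k / D jm) * R2 = (1/40:ℝ)^k * D k * ((R2 * (160*c)^k) / D jm) := by ring
        _ < (1/40:ℝ)^k * D k * 1 := by
          gcongr
          rwa [div_lt_one hDj]
        _ = _ := by ring
    linarith
  · intro t ht
    obtain ⟨p, hp1, hp2⟩ := dfw_chain D W (x + t • v) v
    have hball : nsq (fun m => (x + t • v) m - x m) ≤ R2 := by
      have : (fun m => (x + t • v) m - x m) = t • v := by ext; simp
      rw [this, nsq_smul]
      have := nsq_nonneg v
      have h1 : t ^ 2 ≤ 1 := by have := ht.1; have := ht.2; nlinarith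
      nlinarith
    obtain ⟨j, hj, hjb⟩ := chain_bound hc hD hA k (by omega) (x + t • v) p (fun i _ => hp1 i)
      (fun i hi => ih i (by omega) (by omega) _ hball) _ (hp2 k)
    refine hjb.trans ?_
    have hn := nsq_nonneg v
    have hjle : (D jm : ℝ) ≤ D j := by exact_mod_cast hjmin j (by simp; omega)
    have : nsq (dfw D W (x + t • v) v 0) ≤ R2 := hv
    have hn0 := nsq_nonneg (dfw D W (x + t • v) v 0)
    gcongr

/-- the realised mask -/
def msk (D : ℕ → ℕ) (W : Wts D) (b : Pat D) (y : Fin (D 0) → ℝ) : Pat D :=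
  fun i a => decide (0 < preact D W i y a ∨ (preact D W i y a = 0 ∧ b i a = true))

lemma msk_compat (D : ℕ → ℕ) (W : Wts D) (b : Pat D) (y : Fin (D 0) → ℝ) (i : ℕ) :
    compat (msk D W b y i) (preact D W i y) := by
  intro a
  simp only [msk, decide_eq_true_eq, decide_eq_false_iff_not]
  refine ⟨?_, ?_⟩
  · rintro (h | h)
    · exact h.le
    · exact h.1.ge
  · intro h
    push Not at h
    exact h.1

lemma act01_msk (D : ℕ → ℕ) (W : Wts D) (b : Pat D) (y : Fin (D 0) → ℝ) (i : ℕ) (a : Fin (D (i+1))) :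
    act01 (preact D W i y a) (b i a) = if msk D W b y i a = true then 1 else 0 := by
  simp only [act01, msk, decide_eq_true_eq]
  by_cases h : 0 < preact D W i y a
  · simp [h]
  · simp [h]

lemma Mprod_self (D : ℕ → ℕ) (W : Wts D) (b : Pat D) (y : Fin (D 0) → ℝ) (s : ℕ) (v : Fin (D s) → ℝ) :
    mulVecFn (Mprod D W b y s s) v = v := by
  have : Mprod D W b y s s = fun a c => if a = c then 1 else 0 := by
    ext a c
    cases s with
    | zero => simp [Mprod, Fin.ext_iff]
    | succ t => simp [Mprod, Fin.ext_iff]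
  rw [this]
  ext a
  simp [mulVecFn]

lemma Mprod_step (D : ℕ → ℕ) (W : Wts D) (b : Pat D) (y : Fin (D 0) → ℝ) (s t : ℕ) (hst : s ≤ t)
    (v : Fin (D s) → ℝ) :
    mulVecFn (Mprod D W b y s (t+1)) v =
      fun a => if msk D W b y t a = true then mulVecFn (W t) (mulVecFn (Mprod D W b y s t) v) a else 0 := by
  ext a
  have h1 : Mprod D W b y s (t+1) a =
      fun c => act01 (preact D W t y a) (b t a) * (∑ k, W t a k * Mprod D W b y s t k c) := by
    rw [Mprod, if_neg (by omega)]
  simp only [mulVecFn, h1, act01_msk]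
  split_ifs
  · simp only [one_mul, Finset.sum_mul, Finset.mul_sum]
    rw [Finset.sum_comm]
    exact Finset.sum_congr rfl fun _ _ => Finset.sum_congr rfl fun _ _ => by ring
  · simp

lemma evNorm_eq {n : ℕ} (v : Fin n → ℝ) : evNorm v = Real.sqrt (nsq v) := rfl

lemma specNorm_le {a b : ℕ} (M : Fin a → Fin b → ℝ) (B : ℝ) (hB : 0 ≤ B)
    (h : ∀ v, nsq (mulVecFn M v) ≤ B * nsq v) : specNorm M ≤ Real.sqrt B := by
  apply csSup_le
  · exact ⟨_, 0, by simp [evNorm], rfl⟩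
  · rintro t ⟨v, hv, rfl⟩
    rw [evNorm_eq] at hv ⊢
    apply Real.sqrt_le_sqrt
    have h1 : nsq v ≤ 1 := by
      have := Real.sqrt_le_one.1 hv
      exact this
    refine (h v).trans ?_
    nlinarith

lemma Mprod_bound {ℓ : ℕ} {D : ℕ → ℕ} {c : ℝ} (hc : 1 ≤ c) {W : Wts D} (hD : ∀ i ≤ ℓ, 0 < D i)
    (hA : ∀ s n, s + n < ℓ → ¬ Bad D c W s n) (x : Fin (D 0) → ℝ)
    (hx : ∀ k, k ≤ ℓ → (1/40:ℝ)^k * D k ≤ nsq (forward D W k x)) (R2 : ℝ)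
    (hR : ∀ k, k + 1 < ℓ → ∀ j ≤ ℓ, R2 * (160 * c) ^ k < D j)
    (y : Fin (D 0) → ℝ) (hy : nsq (fun m => y m - x m) ≤ R2) (b : Pat D) (k : ℕ) (hk0 : 0 < k) (hk : k ≤ ℓ)
    (hkm : ∀ i < k, D k < D i) :
    specNorm (Mprod D W b y (argminLt D k) k) ≤ Real.sqrt ((4*c)^(k - argminLt D k)) := by
  obtain ⟨h1, h2⟩ := argminLt_spec D k hk0
  apply specNorm_le _ _ (by positivity)
  intro v
  have hDs : (0:ℝ) < D (argminLt D k) := by exact_mod_cast hD _ (by omega)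
  have := chain_seg hc hA hk0 hk (hD _ (by omega)) (y := y) (p := msk D W b y)
    (fun i _ => msk_compat D W b y i)
    (fun i hi => nonvanish hc hD hA x hx R2 hR i (by omega) y hy)
    (u := fun i => mulVecFn (Mprod D W b y (argminLt D k) i) v)
    (fun i hi _ => Mprod_step D W b y _ i hi v)
  rw [Mprod_self, max_eq_right (hkm _ h1).le, div_self hDs.ne', mul_one] at this
  exact this



/-- hidden weights -/
abbrev HW (ℓ : ℕ) (D : ℕ → ℕ) := ∀ i : Fin ℓ, Fin (D (i.1+1)) → Fin (D i.1) → ℝ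
/-- hidden bits -/
abbrev HB (ℓ : ℕ) (D : ℕ → ℕ) := ∀ i : Fin ℓ, Fin (D (i.1+1)) → Bool

lemma extendW_update_ne {ℓ : ℕ} {D : ℕ → ℕ} (w : HW ℓ D) (i : Fin ℓ) (A) (j : ℕ) (hj : j ≠ i.1) :
    extendW ℓ D (Function.update w i A) j = extendW ℓ D w j := by
  unfold extendW
  split_ifs with h
  · rw [Function.update_of_ne]
    intro he; apply hj; rw [← he]
  · rfl

lemma extendW_update_self {ℓ : ℕ} {D : ℕ → ℕ} (w : HW ℓ D) (j : ℕ) (hj : j < ℓ) (A) :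
    extendW ℓ D (Function.update w ⟨j, hj⟩ A) j = A := by
  unfold extendW
  rw [dif_pos hj, Function.update_self]

lemma extendB_update_ne {ℓ : ℕ} {D : ℕ → ℕ} (w : HB ℓ D) (i : Fin ℓ) (A) (j : ℕ) (hj : j ≠ i.1) :
    extendB ℓ D (Function.update w i A) j = extendB ℓ D w j := by
  unfold extendB
  split_ifs with h
  · rw [Function.update_of_ne]
    intro he; apply hj; rw [← he]
  · rfl

lemma extendB_update_self {ℓ : ℕ} {D : ℕ → ℕ} (w : HB ℓ D) (j : ℕ) (hj : j < ℓ) (A) :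
    extendB ℓ D (Function.update w ⟨j, hj⟩ A) j = A := by
  unfold extendB
  rw [dif_pos hj, Function.update_self]

lemma extendB_restrict {ℓ : ℕ} {D : ℕ → ℕ} (p : Pat D) (j : ℕ) (hj : j < ℓ) :
    extendB ℓ D (fun i => p i.1) j = p j := by
  unfold extendB
  rw [dif_pos hj]

lemma pr_congr {D : ℕ → ℕ} {W W' : Wts D} {p p' : Pat D} {s : ℕ} (v : Fin (D s) → ℝ) (n : ℕ)
    (hW : ∀ t < n, W (s+t) = W' (s+t)) (hp : ∀ t < n, p (s+t) = p' (s+t)) :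
    pr D W p s v n = pr D W' p' s v n := by
  induction n with
  | zero => rfl
  | succ n ih =>
    simp only [pr]
    rw [ih (fun t ht => hW t (by omega)) (fun t ht => hp t (by omega)), hW n (by omega), hp n (by omega)]

lemma Reach_congr {D : ℕ → ℕ} {W W' : Wts D} {p p' : Pat D} {s n : ℕ} {z : Fin (D s) → ℝ}
    (hW : ∀ t < n, W (s+t) = W' (s+t)) (hp : ∀ t < n, p (s+t) = p' (s+t))
    (h : Reach D W p s n z) : Reach D W' p' s n z := by
  intro t ht
  have h1 := h t ht
  rw [pr_congr z t (fun t' ht' => hW t' (by omega)) (fun t' ht' => hp t' (by omega)), hW t ht, hp t ht] at h1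
  exact h1

lemma continuous_extendW {ℓ : ℕ} {D : ℕ → ℕ} (i : ℕ) (a : Fin (D (i+1))) (k : Fin (D i)) :
    Continuous fun w : HW ℓ D => extendW ℓ D w i a k := by
  unfold extendW
  by_cases h : i < ℓ
  · simp only [dif_pos h]
    fun_prop
  · simp only [dif_neg h]
    exact continuous_const

lemma continuous_pr {ℓ : ℕ} {D : ℕ → ℕ} (p : Pat D) (s n : ℕ) :
    Continuous fun q : HW ℓ D × (Fin (D s) → ℝ) => pr D (extendW ℓ D q.1) p s q.2 n := by
  induction n with
  | zero => exact continuous_snd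
  | succ n ih =>
    apply continuous_pi
    intro a
    simp only [pr]
    split_ifs
    · unfold mulVecFn
      apply continuous_finsetSum
      intro k _
      exact ((continuous_extendW (s+n) a k).comp continuous_fst).mul ((continuous_apply k).comp ih)
    · exact continuous_const

lemma continuous_mv_pr {ℓ : ℕ} {D : ℕ → ℕ} (p : Pat D) (s n : ℕ) (j : Fin (D (s+n+1))) :
    Continuous fun q : HW ℓ D × (Fin (D s) → ℝ) =>
      mulVecFn (extendW ℓ D q.1 (s+n)) (pr D (extendW ℓ D q.1) p s q.2 n) j := by
  unfold mulVecFn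
  apply continuous_finsetSum
  intro k _
  exact ((continuous_extendW (s+n) j k).comp continuous_fst).mul
    ((continuous_apply k).comp (continuous_pr p s n))

lemma continuous_nsq {n : ℕ} : Continuous (nsq : (Fin n → ℝ) → ℝ) := by
  unfold nsq; fun_prop

lemma nsq_pos {n : ℕ} {v : Fin n → ℝ} (h : v ≠ 0) : 0 < nsq v := by
  obtain ⟨i, hi⟩ := Function.ne_iff.1 h
  unfold nsq
  apply Finset.sum_pos'
  · intro i _; positivity
  · refine ⟨i, Finset.mem_univ _, ?_⟩
    have : v i ≠ 0 := hi
    positivity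

lemma nsq_zero {n : ℕ} : nsq (0 : Fin n → ℝ) = 0 := by simp [nsq]

/-- general position failure -/
def GPz (D : ℕ → ℕ) (W : Wts D) (p : Pat D) (s t : ℕ) (I : Finset (Fin (D (s+t+1)))) : Prop :=
  ∃ z, pr D W p s z t ≠ 0 ∧ ∀ j ∈ I, mulVecFn (W (s+t)) (pr D W p s z t) j = 0

lemma GPz_measurable {ℓ : ℕ} {D : ℕ → ℕ} (p : Pat D) (s t : ℕ) (I : Finset (Fin (D (s+t+1)))) :
    MeasurableSet {w : HW ℓ D | GPz D (extendW ℓ D w) p s t I} := by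
  let K : Set (HW ℓ D × (Fin (D s) → ℝ)) := {q | 1 ≤ nsq (pr D (extendW ℓ D q.1) p s q.2 t)} ∩
    ⋂ j ∈ I, {q | mulVecFn (extendW ℓ D q.1 (s+t)) (pr D (extendW ℓ D q.1) p s q.2 t) j = 0}
  have hK : IsClosed K := by
    apply IsClosed.inter
    · exact isClosed_le continuous_const (continuous_nsq.comp (continuous_pr p s t))
    · exact isClosed_biInter fun j _ => isClosed_eq (continuous_mv_pr p s t j) continuous_const
  convert measurable_closed_proj K hK using 1
  ext w
  simp only [Set.mem_ofPred_eq, GPz, K, Set.mem_inter_iff, Set.mem_iInter]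
  constructor
  · rintro ⟨z, h1, h2⟩
    have hpos := nsq_pos h1
    set r := nsq (pr D (extendW ℓ D w) p s z t) with hr
    refine ⟨(1 / Real.sqrt r) • z, ?_, ?_⟩
    · rw [pr_smul, nsq_smul, div_pow, Real.sq_sqrt hpos.le, ← hr]
      field_simp
      norm_num
    · intro j hj
      rw [pr_smul, mulVecFn_smul, Pi.smul_apply, h2 j hj, smul_zero]
  · rintro ⟨z, h1, h2⟩
    refine ⟨z, ?_, h2⟩
    intro h0
    rw [h0, nsq_zero] at h1
    linarith

lemma GPz_null {ℓ : ℕ} {D : ℕ → ℕ} (hD : ∀ i ≤ ℓ, 0 < D i) (p : Pat D) (s t : ℕ) (hst : s + t < ℓ)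
    (I : Finset (Fin (D (s+t+1)))) (hI : I.card = D s) :
    hiddenMeasure ℓ D {w : HW ℓ D | GPz D (extendW ℓ D w) p s t I} = 0 := by
  have := pi_update_bound (fun i : Fin ℓ => gaussMat (D (i.1+1)) (D i.1) (1 / (D i.1 : NNReal))) ⟨s+t, hst⟩
    Set.univ {w : HW ℓ D | GPz D (extendW ℓ D w) p s t I} MeasurableSet.univ (GPz_measurable p s t I)
    (fun _ _ _ => Set.mem_univ _) 0 ?_
  · rw [Set.univ_inter, zero_mul] at this
    exact le_antisymm this (zero_le)
  · intro w
    have hv : (1 / (D (s+t) : NNReal)) ≠ 0 := by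
      have := hD (s+t) hst.le
      positivity
    refine (measure_mono ?_).trans (gp_null _ hv (prL D (extendW ℓ D w) p s t) I hI).le
    intro A hA
    obtain ⟨z, h1, h2⟩ := hA
    rw [extendW_update_self] at h2
    have e : pr D (extendW ℓ D (Function.update w ⟨s+t, hst⟩ A)) p s z t = pr D (extendW ℓ D w) p s z t :=
      pr_congr z t (fun t' ht' => extendW_update_ne w _ A _ (by simp; omega)) (fun _ _ => rfl)
    rw [e] at h1 h2
    exact ⟨z, h1, h2⟩

/-- union of the general-position failures -/
def GPbad (ℓ : ℕ) (D : ℕ → ℕ) (s n : ℕ) : Set (HW ℓ D) :=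
  ⋃ t : Fin n, ⋃ b : HB ℓ D, ⋃ I : {I : Finset (Fin (D (s+t.1+1))) // I.card = D s},
    {w | GPz D (extendW ℓ D w) (extendB ℓ D b) s t.1 I.1}

lemma GPbad_measurable (ℓ : ℕ) (D : ℕ → ℕ) (s n : ℕ) : MeasurableSet (GPbad ℓ D s n) :=
  MeasurableSet.iUnion fun _ => MeasurableSet.iUnion fun _ => MeasurableSet.iUnion fun _ =>
    GPz_measurable _ _ _ _

lemma GPbad_null {ℓ : ℕ} {D : ℕ → ℕ} (hD : ∀ i ≤ ℓ, 0 < D i) (s n : ℕ) (hn : s + n < ℓ) :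
    hiddenMeasure ℓ D (GPbad ℓ D s n) = 0 := by
  unfold GPbad
  refine measure_iUnion_null fun t => measure_iUnion_null fun b => measure_iUnion_null fun I => ?_
  exact GPz_null hD _ s t.1 (by omega) I.1 I.2

lemma GPbad_notMem {ℓ : ℕ} {D : ℕ → ℕ} {s n : ℕ} {w : HW ℓ D} (h : w ∉ GPbad ℓ D s n) (t : ℕ) (ht : t < n)
    (b : HB ℓ D) (I : Finset (Fin (D (s+t+1)))) (hI : I.card = D s) :
    ¬ GPz D (extendW ℓ D w) (extendB ℓ D b) s t I := by
  intro hg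
  apply h
  simp only [GPbad, Set.mem_iUnion]
  exact ⟨⟨t, ht⟩, b, ⟨I, hI⟩, hg⟩

lemma count_reach {ℓ : ℕ} {D : ℕ → ℕ} {W : Wts D} {s dM : ℕ} (hM : ∀ i ≤ ℓ, D i ≤ dM) (n : ℕ) (hn : s + n < ℓ + 1)
    (hG : ∀ t < n, ∀ (b : HB ℓ D) (I : Finset (Fin (D (s+t+1)))), I.card = D s →
      ¬ GPz D W (extendB ℓ D b) s t I) :
    ∃ F : Finset (HB ℓ D), F.card ≤ ((dM + 1) ^ D s * (dM + 1) ^ D s) ^ n ∧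
      ∀ (p : Pat D) z, Reach D W p s n z → ∃ q ∈ F, ∀ t < n, p (s+t) = extendB ℓ D q (s+t) := by
  classical
  induction n with
  | zero =>
    exact ⟨{fun _ _ => false}, by simp, fun p z _ => ⟨_, Finset.mem_singleton_self _, by simp⟩⟩
  | succ n ih =>
    obtain ⟨F, hF, hFr⟩ := ih (by omega) (fun t ht => hG t (by omega))
    have hcp : ∀ q : HB ℓ D, ∃ Fq : Finset (Fin (D (s+n+1)) → Bool),
        Fq.card ≤ (dM + 1) ^ D s * (dM + 1) ^ D s ∧ ∀ r z, pr D W (extendB ℓ D q) s z n ≠ 0 →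
        compat r (mulVecFn (W (s+n)) (pr D W (extendB ℓ D q) s z n)) → r ∈ Fq := by
      intro q
      let φ : Fin (D (s+n+1)) → ((Fin (D s) → ℝ) →ₗ[ℝ] ℝ) := fun j =>
        { toFun := fun z => mulVecFn (W (s+n)) (pr D W (extendB ℓ D q) s z n) j
          map_add' := by intro u v; rw [pr_add, mulVecFn_add]; rfl
          map_smul' := by intro c v; rw [pr_smul, mulVecFn_smul]; rfl }
      obtain ⟨Fq, h1, h2⟩ := count_patterns φ {z | pr D W (extendB ℓ D q) s z n ≠ 0} (by
        intro z hz I hI hzero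
        exact hG n (by omega) q I hI ⟨z, hz, hzero⟩)
      refine ⟨Fq, h1.trans ?_, ?_⟩
      · have := hM (s+n+1) (by omega)
        gcongr
      · intro r z hz hc
        exact h2 r z hz (fun j => (hc j).1) (fun j => (hc j).2)
    choose Fq hFq1 hFq2 using hcp
    have hsn : s + n < ℓ := by omega
    refine ⟨F.biUnion fun q => (Fq q).image fun r => Function.update q ⟨s+n, hsn⟩ r, ?_, ?_⟩
    · refine Finset.card_biUnion_le.trans ?_
      calc ∑ q ∈ F, ((Fq q).image fun r => Function.update q ⟨s+n, hsn⟩ r).card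
          ≤ ∑ _q ∈ F, ((dM + 1) ^ D s * (dM + 1) ^ D s) :=
            Finset.sum_le_sum fun q _ => Finset.card_image_le.trans (hFq1 q)
        _ = F.card * ((dM + 1) ^ D s * (dM + 1) ^ D s) := by simp
        _ ≤ _ := by rw [pow_succ]; gcongr
    · intro p z hR
      obtain ⟨q, hq, hqp⟩ := hFr p z (hR.mono (by omega))
      have hR' := hR n (by omega)
      rw [pr_congr (W' := W) z n (fun _ _ => rfl) hqp] at hR'
      have hr := hFq2 q (p (s+n)) z hR'.1 hR'.2
      refine ⟨Function.update q ⟨s+n, hsn⟩ (p (s+n)), ?_, ?_⟩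
      · rw [Finset.mem_biUnion]
        exact ⟨q, hq, Finset.mem_image_of_mem _ hr⟩
      · intro t ht
        rcases Nat.lt_succ_iff_lt_or_eq.1 ht with h | h
        · rw [extendB_update_ne _ _ _ _ (by simp; omega)]
          exact hqp t h
        · subst h
          rw [extendB_update_self]

lemma compat_smul {n : ℕ} {q : Fin n → Bool} {g : Fin n → ℝ} (h : compat q g) (c : ℝ) (hc : 0 ≤ c) :
    compat q (c • g) := by
  intro a
  refine ⟨fun hq => ?_, fun hq => ?_⟩
  · exact mul_nonneg hc ((h a).1 hq)
  · exact mul_nonpos_of_nonneg_of_nonpos hc ((h a).2 hq)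

lemma Reach_measurable {ℓ : ℕ} {D : ℕ → ℕ} (p : Pat D) (s n : ℕ) :
    MeasurableSet {w : HW ℓ D | ∃ z, Reach D (extendW ℓ D w) p s n z} := by
  let K : Set (HW ℓ D × (Fin (D s) → ℝ)) := ⋂ t ∈ Finset.range n,
    ({q | 1 ≤ nsq (pr D (extendW ℓ D q.1) p s q.2 t)} ∩
    ⋂ j, ({q | p (s+t) j = true → 0 ≤ mulVecFn (extendW ℓ D q.1 (s+t)) (pr D (extendW ℓ D q.1) p s q.2 t) j} ∩
     {q | p (s+t) j = false → mulVecFn (extendW ℓ D q.1 (s+t)) (pr D (extendW ℓ D q.1) p s q.2 t) j ≤ 0}))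
  have hK : IsClosed K := by
    refine isClosed_biInter fun t _ => ?_
    apply IsClosed.inter
    · exact isClosed_le continuous_const (continuous_nsq.comp (continuous_pr p s t))
    · refine isClosed_iInter fun j => ?_
      apply IsClosed.inter
      · by_cases h : p (s+t) j = true
        · simp only [h, forall_const]
          exact isClosed_le continuous_const (continuous_mv_pr p s t j)
        · simp [h]
      · by_cases h : p (s+t) j = false
        · simp only [h, forall_const]
          exact isClosed_le (continuous_mv_pr p s t j) continuous_const
        · simp [h]
  convert measurable_closed_proj K hK using 1
  ext w
  simp only [Set.mem_ofPred_eq, Reach, compat, K, Set.mem_inter_iff, Set.mem_iInter, Finset.mem_range]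
  constructor
  · rintro ⟨z, hz⟩
    let r : ℕ → ℝ := fun t => nsq (pr D (extendW ℓ D w) p s z t)
    have hr0 : ∀ t < n, 0 < r t := fun t ht => nsq_pos (hz t ht).1
    let lam : ℝ := 1 + ∑ t ∈ Finset.range n, 1 / r t
    have hlam : 1 ≤ lam := by
      have : 0 ≤ ∑ t ∈ Finset.range n, 1 / r t := Finset.sum_nonneg fun t ht =>
        (one_div_pos.2 (hr0 t (Finset.mem_range.1 ht))).le
      simp only [lam]; linarith
    refine ⟨lam • z, fun t ht => ⟨?_, ?_⟩⟩
    · rw [pr_smul, nsq_smul]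
      change 1 ≤ lam ^ 2 * r t
      have h1 : 1 / r t ≤ lam := by
        have := Finset.single_le_sum (f := fun t => 1 / r t) (s := Finset.range n) (fun t ht =>
          (one_div_pos.2 (hr0 t (Finset.mem_range.1 ht))).le) (Finset.mem_range.2 ht)
        simp only [lam]
        linarith
      have h2 : 1 ≤ lam * r t := by rwa [div_le_iff₀ (hr0 t ht)] at h1
      have := hr0 t ht
      nlinarith
    · have := compat_smul (hz t ht).2 lam (by linarith)
      rw [pr_smul, mulVecFn_smul]
      exact this
  · rintro ⟨z, hz⟩
    refine ⟨z, fun t ht => ⟨?_, (hz t ht).2⟩⟩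
    intro h0
    have := (hz t ht).1
    rw [h0, nsq_zero] at this
    linarith

lemma StepBad_measurable {ℓ : ℕ} {D : ℕ → ℕ} (c : ℝ) (p : Pat D) (s n : ℕ) :
    MeasurableSet {w : HW ℓ D | StepBad D c (extendW ℓ D w) p s n} := by
  unfold StepBad
  have : {w : HW ℓ D | ∃ v ∈ net (D s), c * (max (D (s+n+1)) (D s) : ℕ) * (1 / (D (s+n) : ℝ)) * nsq (pr D (extendW ℓ D w) p s v n)
    < nsq (mulVecFn (extendW ℓ D w (s+n)) (pr D (extendW ℓ D w) p s v n))} = 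
    ⋃ v ∈ net (D s), {w : HW ℓ D | c * (max (D (s+n+1)) (D s) : ℕ) * (1 / (D (s+n) : ℝ)) * nsq (pr D (extendW ℓ D w) p s v n)
    < nsq (mulVecFn (extendW ℓ D w (s+n)) (pr D (extendW ℓ D w) p s v n))} := by
    ext w; simp
  rw [this]
  refine Finset.measurableSet_biUnion _ fun v _ => ?_
  have h1 : Continuous fun w : HW ℓ D => pr D (extendW ℓ D w) p s v n :=
    (continuous_pr p s n).comp (Continuous.prodMk_left v)
  have h2 : Continuous fun w : HW ℓ D => mulVecFn (extendW ℓ D w (s+n)) (pr D (extendW ℓ D w) p s v n) :=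
    continuous_pi fun j => (continuous_mv_pr p s n j).comp (Continuous.prodMk_left v)
  exact (isOpen_lt (continuous_const.mul (continuous_nsq.comp h1)) (continuous_nsq.comp h2)).measurableSet

lemma Bad_bound {ℓ : ℕ} {D : ℕ → ℕ} (hD : ∀ i ≤ ℓ, 0 < D i) {dM : ℕ} (hM : ∀ i ≤ ℓ, D i ≤ dM) (c : ℝ)
    (s n : ℕ) (hn : s + n < ℓ) :
    hiddenMeasure ℓ D {w : HW ℓ D | Bad D c (extendW ℓ D w) s n} ≤
      ((((dM + 1) ^ D s * (dM + 1) ^ D s) ^ n * 5 ^ D s : ℕ) : ENNReal) *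
      ENNReal.ofReal (Real.exp (-(c * (max (D (s+n+1)) (D s) : ℕ)) / 4) * Real.sqrt 2 ^ D (s+n+1)) := by
  classical
  set ε := ENNReal.ofReal (Real.exp (-(c * (max (D (s+n+1)) (D s) : ℕ)) / 4) * Real.sqrt 2 ^ D (s+n+1)) with hε
  let T : Set (HW ℓ D) := (GPbad ℓ D s n)ᶜ ∩ ⋃ b : HB ℓ D, 
    ({w : HW ℓ D | ∃ z, Reach D (extendW ℓ D w) (extendB ℓ D b) s n z} ∩
      {w : HW ℓ D | StepBad D c (extendW ℓ D w) (extendB ℓ D b) s n})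
  have hT : MeasurableSet T := (GPbad_measurable ℓ D s n).compl.inter
    (MeasurableSet.iUnion fun b => (Reach_measurable _ s n).inter (StepBad_measurable c _ s n))
  have hsub : {w : HW ℓ D | Bad D c (extendW ℓ D w) s n} ⊆ GPbad ℓ D s n ∪ T := by
    rintro w ⟨p, z, hR, v, hv, hs⟩
    by_cases hg : w ∈ GPbad ℓ D s n
    · exact Or.inl hg
    refine Or.inr ⟨hg, ?_⟩
    rw [Set.mem_iUnion]
    have hp : ∀ t < n, p (s+t) = extendB ℓ D (fun i => p i.1) (s+t) := fun t ht =>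
      (extendB_restrict p (s+t) (by omega)).symm
    refine ⟨fun i => p i.1, ⟨z, Reach_congr (fun _ _ => rfl) hp hR⟩, v, hv, ?_⟩
    rw [pr_congr (W' := extendW ℓ D w) v n (fun _ _ => rfl) hp] at hs
    exact hs
  refine (measure_mono hsub).trans ((measure_union_le _ _).trans ?_)
  rw [GPbad_null hD s n hn, zero_add]
  have := pi_update_bound (fun i : Fin ℓ => gaussMat (D (i.1+1)) (D i.1) (1 / (D i.1 : NNReal))) ⟨s+n, hn⟩
    Set.univ T MeasurableSet.univ hT (fun _ _ _ => Set.mem_univ _)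
    ((((dM + 1) ^ D s * (dM + 1) ^ D s) ^ n * 5 ^ D s : ℕ) * ε) ?_
  · rw [Set.univ_inter] at this
    refine this.trans ?_
    rw [measure_univ, mul_one]
  · intro w
    by_cases hne : ∃ A0, Function.update w ⟨s+n, hn⟩ A0 ∈ T
    swap
    · push Not at hne
      have : {a | Function.update w ⟨s+n, hn⟩ a ∈ T} = ∅ := Set.eq_empty_of_forall_notMem hne
      rw [this]; simp
    obtain ⟨A0, hA0⟩ := hne
    have hupd : ∀ A, ∀ t < n, extendW ℓ D (Function.update w ⟨s+n, hn⟩ A) (s+t) = extendW ℓ D w (s+t) :=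
      fun A t ht => extendW_update_ne w _ A _ (by simp; omega)
    set W := extendW ℓ D w with hW
    obtain ⟨F, hF, hFr⟩ := count_reach (W := extendW ℓ D (Function.update w ⟨s+n, hn⟩ A0)) (s := s) hM n (by omega)
      (fun t ht b I hI => GPbad_notMem hA0.1 t ht b I hI)
    have hsub2 : {A | Function.update w ⟨s+n, hn⟩ A ∈ T} ⊆ ⋃ qv ∈ F ×ˢ net (D s),
        {A : Fin (D (s+n+1)) → Fin (D (s+n)) → ℝ | 
          (c * (max (D (s+n+1)) (D s) : ℕ)) * ((1 / (D (s+n) : NNReal) : NNReal) : ℝ) * nsq (pr D W (extendB ℓ D qv.1) s qv.2 n)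
            < nsq (mulVecFn A (pr D W (extendB ℓ D qv.1) s qv.2 n))} := by
      intro A hA
      obtain ⟨_, hA⟩ := hA
      rw [Set.mem_iUnion] at hA
      obtain ⟨b, ⟨z, hR⟩, v, hv, hs⟩ := hA
      obtain ⟨q, hq, hqb⟩ := hFr (extendB ℓ D b) z (Reach_congr
        (fun t ht => (hupd A t ht).trans (hupd A0 t ht).symm) (fun _ _ => rfl) hR)
      simp only [Set.mem_iUnion]
      refine ⟨(q, v), Finset.mem_product.2 ⟨hq, hv⟩, ?_⟩
      rw [extendW_update_self, pr_congr (W' := W) v n (hupd A) hqb] at hs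
      simpa using hs
    refine (measure_mono hsub2).trans ((measure_biUnion_finset_le _ _).trans ?_)
    have hv0 : (1 / (D (s+n) : NNReal)) ≠ 0 := by
      have := hD (s+n) hn.le
      positivity
    calc _ ≤ ∑ _qv ∈ F ×ˢ net (D s), ε := by
          apply Finset.sum_le_sum
          intro qv _
          exact chi_upper _ hv0 _ _
      _ = ((F ×ˢ net (D s)).card : ENNReal) * ε := by simp
      _ ≤ _ := by
        gcongr
        rw [Finset.card_product]
        exact Nat.mul_le_mul hF (net_card _)


lemma forward_congr {D : ℕ → ℕ} {W W' : Wts D} (k : ℕ) (h : ∀ j < k, W j = W' j) (x : Fin (D 0) → ℝ) :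
    forward D W k x = forward D W' k x := by
  induction k with
  | zero => rfl
  | succ k ih =>
    simp only [forward]
    rw [ih (fun j hj => h j (by omega)), h k (by omega)]

lemma continuous_forward_w {ℓ : ℕ} {D : ℕ → ℕ} (k : ℕ) (x : Fin (D 0) → ℝ) :
    Continuous fun w : HW ℓ D => forward D (extendW ℓ D w) k x := by
  induction k with
  | zero => exact continuous_const
  | succ k ih =>
    apply continuous_pi
    intro a
    simp only [forward]
    refine Continuous.max ?_ continuous_const
    apply continuous_finsetSum
    intro j _
    exact (continuous_extendW k a j).mul ((continuous_apply j).comp ih)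

/-- lower-bound failure at one layer -/
def LowBad (ℓ : ℕ) (D : ℕ → ℕ) (x : Fin (D 0) → ℝ) (k : ℕ) : Set (HW ℓ D) :=
  {w | nsq (forward D (extendW ℓ D w) (k+1) x) <
    (1/40) * D (k+1) * (1 / (D k : ℝ)) * nsq (forward D (extendW ℓ D w) k x)}

lemma LowBad_measurable (ℓ : ℕ) (D : ℕ → ℕ) (x : Fin (D 0) → ℝ) (k : ℕ) : MeasurableSet (LowBad ℓ D x k) :=
  (isOpen_lt (continuous_nsq.comp (continuous_forward_w (k+1) x))
    (continuous_const.mul (continuous_nsq.comp (continuous_forward_w k x)))).measurableSet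

/-- good event for the first `k` layers -/
def LowGood (ℓ : ℕ) (D : ℕ → ℕ) (x : Fin (D 0) → ℝ) (k : ℕ) : Set (HW ℓ D) :=
  {w | ∀ j < k, w ∉ LowBad ℓ D x j}

lemma LowGood_measurable (ℓ : ℕ) (D : ℕ → ℕ) (x : Fin (D 0) → ℝ) (k : ℕ) : MeasurableSet (LowGood ℓ D x k) := by
  have : LowGood ℓ D x k = ⋂ j ∈ Finset.range k, (LowBad ℓ D x j)ᶜ := by
    ext w; simp [LowGood]
  rw [this]
  exact Finset.measurableSet_biInter _ fun j _ => (LowBad_measurable ℓ D x j).compl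

instance hiddenMeasure_prob (ℓ : ℕ) (D : ℕ → ℕ) : IsProbabilityMeasure (hiddenMeasure ℓ D) := by
  unfold hiddenMeasure; infer_instance

lemma LowGood_prob {ℓ : ℕ} {D : ℕ → ℕ} (hD : ∀ i ≤ ℓ, 0 < D i) {m : ℕ} (hm : ∀ i ≤ ℓ, m ≤ D i)
    (x : Fin (D 0) → ℝ) (k : ℕ) (hk : k ≤ ℓ) :
    (1 - (3/4:ℝ)^m)^k ≤ (hiddenMeasure ℓ D).real (LowGood ℓ D x k) := by
  induction k with
  | zero =>
    have : LowGood ℓ D x 0 = Set.univ := by ext; simp [LowGood]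
    rw [this]; simp
  | succ k ih =>
    have ih := ih (by omega)
    have hq0 : (0:ℝ) ≤ (3/4)^m := by positivity
    have hq1 : (3/4:ℝ)^m ≤ 1 := pow_le_one₀ (by norm_num) (by norm_num)
    have hb := pi_update_bound (fun i : Fin ℓ => gaussMat (D (i.1+1)) (D i.1) (1 / (D i.1 : NNReal))) ⟨k, hk⟩
      (LowGood ℓ D x k) (LowBad ℓ D x k) (LowGood_measurable ℓ D x k) (LowBad_measurable ℓ D x k)
      ?_ (ENNReal.ofReal ((3/4)^m)) ?_
    · have hb' : (hiddenMeasure ℓ D).real (LowGood ℓ D x k ∩ LowBad ℓ D x k) ≤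
          (3/4)^m * (hiddenMeasure ℓ D).real (LowGood ℓ D x k) := by
        have h1 := ENNReal.toReal_mono (ENNReal.mul_ne_top ENNReal.ofReal_ne_top (measure_ne_top _ _)) hb
        rw [ENNReal.toReal_mul, ENNReal.toReal_ofReal hq0] at h1
        exact h1
      have hsplit : LowGood ℓ D x (k+1) = LowGood ℓ D x k \ LowBad ℓ D x k := by
        ext w
        simp only [LowGood, Set.mem_sdiff, Set.mem_ofPred_eq]
        constructor
        · intro h; exact ⟨fun j hj => h j (by omega), h k (by omega)⟩
        · rintro ⟨h1, h2⟩ j hj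
          rcases Nat.lt_succ_iff_lt_or_eq.1 hj with h | h
          · exact h1 j h
          · subst h; exact h2
      have h2 := measureReal_inter_add_sdiff (μ := hiddenMeasure ℓ D) (s := LowGood ℓ D x k) (LowBad_measurable ℓ D x k)
      rw [hsplit, pow_succ]
      nlinarith
    · intro w A hw j hj hbad
      apply hw j hj
      simp only [LowBad, Set.mem_ofPred_eq] at hbad ⊢
      rw [forward_congr (W' := extendW ℓ D w) (j+1) (fun i hi => extendW_update_ne w _ A _ (by simp; omega)),
        forward_congr (W' := extendW ℓ D w) j (fun i hi => extendW_update_ne w _ A _ (by simp; omega))] at hbad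
      exact hbad
    · intro w
      have hv0 : (1 / (D k : NNReal)) ≠ 0 := by
        have := hD k (by omega)
        positivity
      refine (measure_mono ?_).trans ((relu_lower (a := D (k+1)) (1 / (D k : NNReal)) hv0 (forward D (extendW ℓ D w) k x)).trans ?_)
      · intro A hA
        simp only [LowBad, Set.mem_ofPred_eq, forward] at hA ⊢
        rw [extendW_update_self, forward_congr (W' := extendW ℓ D w) k (fun i hi => extendW_update_ne w _ A _ (by simp; omega))] at hA
        simpa [mulVecFn] using hA
      · apply ENNReal.ofReal_le_ofReal
        exact pow_le_pow_of_le_one (by norm_num) (by norm_num) (hm _ hk)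

lemma LowGood_lower {ℓ : ℕ} {D : ℕ → ℕ} (hD : ∀ i ≤ ℓ, 0 < D i) {x : Fin (D 0) → ℝ} (hx : nsq x = D 0) {w : HW ℓ D}
    (hw : w ∈ LowGood ℓ D x ℓ) (k : ℕ) (hk : k ≤ ℓ) :
    (1/40:ℝ)^k * D k ≤ nsq (forward D (extendW ℓ D w) k x) := by
  induction k with
  | zero => simp [forward, hx]
  | succ k ih =>
    have ih := ih (by omega)
    have h1 := hw k (by omega)
    simp only [LowBad, Set.mem_ofPred_eq, not_lt] at h1
    refine le_trans ?_ h1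
    have hDk : (0:ℝ) < D k := by exact_mod_cast hD k (by omega)
    calc (1/40:ℝ)^(k+1) * D (k+1) = (1/40) * D (k+1) * (1 / (D k : ℝ)) * ((1/40:ℝ)^k * D k) := by
          field_simp
          ring
      _ ≤ _ := by gcongr

lemma bad_numeric {ℓ n dM Ds a : ℕ} (hn : n < ℓ) (hM : 2 ≤ dM) :
    ((((dM + 1) ^ Ds * (dM + 1) ^ Ds) ^ n * 5 ^ Ds : ℕ) : ENNReal) *
      ENNReal.ofReal (Real.exp (-((100 * (ℓ * Real.log dM)) * (max a Ds : ℕ)) / 4) * Real.sqrt 2 ^ a) ≤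
    ENNReal.ofReal (Real.exp (-(11 * ℓ * Ds))) := by
  rw [← ENNReal.ofReal_natCast, ← ENNReal.ofReal_mul (by positivity)]
  apply ENNReal.ofReal_le_ofReal
  set L := Real.log dM with hL
  have hdM : (2:ℝ) ≤ dM := by exact_mod_cast hM
  have hdM0 : (0:ℝ) < dM := by linarith
  have hL2 : Real.log 2 ≤ L := Real.log_le_log (by norm_num) hdM
  have hl2 := Real.log_two_gt_d9
  have h1 : ((dM + 1 : ℕ) : ℝ) ≤ Real.exp (2 * L) := by
    rw [two_mul, Real.exp_add, hL, Real.exp_log hdM0]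
    push_cast
    nlinarith
  have h5 : (5:ℝ) ≤ Real.exp 2 := by
    have := Real.exp_one_gt_d9
    have h : Real.exp 2 = Real.exp 1 * Real.exp 1 := by rw [← Real.exp_add]; norm_num
    rw [h]; nlinarith
  have hs2 : Real.sqrt 2 ≤ Real.exp (1/2) := by
    have h3 : Real.sqrt 2 ≤ 3/2 := by
      rw [Real.sqrt_le_left (by norm_num)]; norm_num
    have := Real.add_one_le_exp (1/2:ℝ)
    linarith
  set m : ℝ := ((max a Ds : ℕ) : ℝ) with hm
  have hma : (a:ℝ) ≤ m := by rw [hm]; exact_mod_cast le_max_left _ _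
  have hmd : (Ds:ℝ) ≤ m := by rw [hm]; exact_mod_cast le_max_right _ _
  have hm0 : 0 ≤ m := by rw [hm]; positivity
  have hℓ : (1:ℝ) ≤ ℓ := by exact_mod_cast (by omega : 1 ≤ ℓ)
  have hnl : (n:ℝ) ≤ ℓ := by exact_mod_cast hn.le
  push_cast
  push_cast at h1
  calc ((((dM:ℝ) + 1) ^ Ds * ((dM:ℝ) + 1) ^ Ds) ^ n * 5 ^ Ds) *
      (Real.exp (-((100 * (ℓ * L)) * m) / 4) * Real.sqrt 2 ^ a)
      ≤ ((Real.exp (2*L) ^ Ds * Real.exp (2*L) ^ Ds) ^ n * Real.exp 2 ^ Ds) *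
      (Real.exp (-((100 * (ℓ * L)) * m) / 4) * Real.exp (1/2) ^ a) := by gcongr
    _ = Real.exp (n * (Ds * (2*L) + Ds * (2 * L)) + Ds * 2 + (-((100 * (ℓ * L)) * m) / 4 + a * (1/2))) := by
      simp only [Real.exp_add, Real.exp_nat_mul]
    _ ≤ _ := by
      apply Real.exp_le_exp.2
      have hL0 : 0 < L := by linarith
      have e1 : (n:ℝ) * Ds ≤ ℓ * m := by gcongr
      have e2 : (n:ℝ) * Ds * L ≤ ℓ * m * L := by gcongr
      have e3 : m ≤ ℓ * m := by nlinarith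
      have e4 : ℓ * m * 0.69 ≤ ℓ * m * L := by
        have : 0 ≤ ℓ * m := by positivity
        nlinarith
      have e5 : (ℓ:ℝ) * Ds ≤ ℓ * m := by gcongr
      nlinarith

lemma final_numeric {ℓ m : ℕ} (hℓ : 1 ≤ ℓ) (hm : 1 ≤ m) {K δ : ℝ} (hδ : δ ∈ Set.Ioo (0:ℝ) 1)
    (hK : (690 * (ℓ:ℝ)) ^ ℓ ≤ K) (h : K * Real.log (1/δ) ≤ m) :
    1 - δ ≤ (1 - (3/4:ℝ)^m)^ℓ - Real.exp (-(9 * ℓ * m)) := by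
  have hℓ' : (1:ℝ) ≤ ℓ := by exact_mod_cast hℓ
  have hm' : (1:ℝ) ≤ m := by exact_mod_cast hm
  have hK1 : 690 ^ ℓ * (ℓ:ℝ) ≤ K := by
    refine le_trans ?_ hK
    rw [mul_pow]
    gcongr
    exact le_self_pow₀ hℓ' (by omega)
  have h690 : (690:ℝ) ≤ 690 ^ ℓ := le_self_pow₀ (by norm_num) (by omega)
  have hK2 : 690 ≤ K := by nlinarith
  have hK0 : 0 < K := by linarith
  have hlog : Real.log (1/δ) ≤ m / K := by rw [le_div_iff₀ hK0]; linarith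
  rw [one_div, Real.log_inv] at hlog
  by_cases hc : (m:ℝ) < 20 * ℓ
  · have h1 : 1 - δ ≤ m / K := by
      have := Real.log_le_sub_one_of_pos hδ.1
      linarith
    have h2 : m / K ≤ 20 / 690 ^ ℓ := by
      rw [div_le_div_iff₀ hK0 (by positivity)]
      have h6 : (0:ℝ) < 690 ^ ℓ := by positivity
      nlinarith
    have h3 : (1/4:ℝ)^ℓ ≤ (1 - (3/4:ℝ)^m)^ℓ := by
      have : (3/4:ℝ)^m ≤ 3/4 := pow_le_of_le_one (by norm_num) (by norm_num) (by omega)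
      gcongr
      linarith
    have h4 : Real.exp (-(9*ℓ*m)) ≤ (1/8)^ℓ := by
      have e1 : Real.exp (-9) ≤ 1/8 := by
        have : (8:ℝ) ≤ Real.exp 9 := by
          have := Real.add_one_le_exp (9:ℝ); linarith
        rw [Real.exp_neg, one_div]
        exact inv_anti₀ (by norm_num) this
      calc Real.exp (-(9*ℓ*m)) ≤ Real.exp (ℓ * (-9)) := by
            apply Real.exp_le_exp.2; nlinarith
        _ = Real.exp (-9) ^ ℓ := Real.exp_nat_mul _ _
        _ ≤ _ := by gcongr
    have h5 : (1/8:ℝ)^ℓ ≤ (1/4)^ℓ * (1/2) := by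
      have : (1/8:ℝ)^ℓ = (1/4)^ℓ * (1/2)^ℓ := by rw [← mul_pow]; norm_num
      rw [this]
      gcongr
      exact pow_le_of_le_one (by norm_num) (by norm_num) (by omega)
    have h6 : (20:ℝ) / 690 ^ ℓ ≤ (1/4)^ℓ * (1/2) := by
      have e : (20:ℝ) / 690 ^ ℓ = (1/4)^ℓ * (20 * (4/690)^ℓ) := by
        rw [div_pow, div_pow, one_pow]; field_simp
      rw [e]
      have : (4/690:ℝ)^ℓ ≤ 4/690 := pow_le_of_le_one (by norm_num) (by norm_num) (by omega)
      gcongr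
      linarith
    linarith
  · push Not at hc
    have hb : 1 + (ℓ:ℝ) * (-(3/4:ℝ)^m) ≤ (1 + (-(3/4:ℝ)^m))^ℓ := by
      apply one_add_mul_le_pow
      have : (3/4:ℝ)^m ≤ 1 := pow_le_one₀ (by norm_num) (by norm_num)
      linarith
    have hq : (3/4:ℝ)^m ≤ Real.exp (-(m/4)) := by
      have e : (3/4:ℝ) ≤ Real.exp (-(1/4)) := by
        have := Real.add_one_le_exp (-(1/4):ℝ); linarith
      calc (3/4:ℝ)^m ≤ Real.exp (-(1/4)) ^ m := by gcongr
        _ = Real.exp (m * (-(1/4))) := (Real.exp_nat_mul _ _).symm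
        _ = _ := by congr 1; ring
    have h9 : Real.exp (-(9*ℓ*m)) ≤ Real.exp (-(m/4)) := by
      apply Real.exp_le_exp.2; nlinarith
    have hE := Real.exp_pos (-(m/4:ℝ))
    have hl1 : (ℓ:ℝ) + 1 ≤ Real.exp (m/20) := by
      refine (Real.add_one_le_exp (ℓ:ℝ)).trans (Real.exp_le_exp.2 ?_)
      linarith
    have hδ2 : Real.exp (-(m/K)) ≤ δ := by
      rw [← Real.exp_log hδ.1]
      apply Real.exp_le_exp.2
      linarith
    have hmul : ((ℓ:ℝ) + 1) * Real.exp (-(m/4)) ≤ Real.exp (-(m/K)) := by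
      calc ((ℓ:ℝ) + 1) * Real.exp (-(m/4)) ≤ Real.exp (m/20) * Real.exp (-(m/4)) := by gcongr
        _ = Real.exp (m/20 + -(m/4)) := (Real.exp_add _ _).symm
        _ ≤ _ := by
          apply Real.exp_le_exp.2
          have : (m:ℝ)/K ≤ m/690 := by gcongr
          linarith
    have : (1 + (-(3/4:ℝ)^m)) = 1 - (3/4:ℝ)^m := by ring
    rw [this] at hb
    nlinarith

lemma radius_numeric {ℓ k : ℕ} (hk : k + 1 < ℓ) {L : ℝ} (hL : Real.log 2 ≤ L) {m : ℝ} (hm : 0 < m) :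
    (Real.sqrt m / ((ℓ:ℝ) * L) ^ (80 * (ℓ:ℝ))) ^ 2 * (160 * (100 * (ℓ * L))) ^ k < m := by
  have hl2 := Real.log_two_gt_d9
  have hℓ : (2:ℝ) ≤ ℓ := by exact_mod_cast (by omega : 2 ≤ ℓ)
  set q : ℝ := ℓ * L with hq
  have hq1 : 1.38 ≤ q := by nlinarith
  have hq0 : 0 < q := by linarith
  have e : (q ^ (80 * (ℓ:ℝ))) ^ 2 = (q ^ 160) ^ ℓ := by
    have : (80 * (ℓ:ℝ)) = ((80 * ℓ : ℕ) : ℝ) := by push_cast; ring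
    rw [this, Real.rpow_natCast, ← pow_mul, ← pow_mul]
    congr 1; ring
  rw [div_pow, Real.sq_sqrt hm.le, e, div_mul_eq_mul_div, div_lt_iff₀ (by positivity)]
  have h1 : 160 * (100 * q) ≤ q ^ 160 := by
    have h2 : (16000:ℝ) ≤ q ^ 159 := by
      calc (16000:ℝ) ≤ 1.38 ^ 159 := by norm_num
        _ ≤ _ := by gcongr
    calc 160 * (100 * q) = 16000 * q := by ring
      _ ≤ q ^ 159 * q := by gcongr
      _ = q ^ 160 := by ring
  have h3 : 1 < q ^ 160 := one_lt_pow₀ (by linarith) (by norm_num)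
  have h4 : (160 * (100 * q)) ^ k < (q ^ 160) ^ ℓ := by
    calc (160 * (100 * q)) ^ k ≤ (q^160)^k := by gcongr
      _ < _ := pow_lt_pow_right₀ h3 (by omega)
  gcongr


lemma dmin_le (ℓ : ℕ) (D : ℕ → ℕ) (i : ℕ) (hi : i ≤ ℓ) : dminN ℓ D ≤ D i :=
  Nat.sInf_le ⟨i, hi, rfl⟩

lemma le_dmax (ℓ : ℕ) (D : ℕ → ℕ) (i : ℕ) (hi : i ≤ ℓ) : D i ≤ dmaxN ℓ D :=
  le_csSup ((Set.finite_Iic ℓ).image D).bddAbove ⟨i, hi, rfl⟩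

lemma specNorm_zero_rows {a b : ℕ} (ha : a = 0) (M : Fin a → Fin b → ℝ) : specNorm M ≤ 0 := by
  subst ha
  have := specNorm_le M 0 le_rfl (fun v => by simp [nsq])
  simpa using this

lemma extendW_bad_union {ℓ : ℕ} {D : ℕ → ℕ} (hℓ : 1 ≤ ℓ) (hD : ∀ i ≤ ℓ, 0 < D i) {m dM : ℕ}
    (hm : ∀ i ≤ ℓ, m ≤ D i) (hm1 : 1 ≤ m)
    (hM : ∀ i ≤ ℓ, D i ≤ dM) (hM2 : 2 ≤ dM) :
    hiddenMeasure ℓ D {w : HW ℓ D | ∃ s n, s + n < ℓ ∧ Bad D (100 * (ℓ * Real.log dM)) (extendW ℓ D w) s n} ≤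
      ENNReal.ofReal (Real.exp (-(9 * ℓ * m))) := by
  have hsub : {w : HW ℓ D | ∃ s n, s + n < ℓ ∧ Bad D (100 * (ℓ * Real.log dM)) (extendW ℓ D w) s n} ⊆
      ⋃ q ∈ Finset.range ℓ ×ˢ Finset.range ℓ,
        {w : HW ℓ D | q.1 + q.2 < ℓ ∧ Bad D (100 * (ℓ * Real.log dM)) (extendW ℓ D w) q.1 q.2} := by
    rintro w ⟨s, n, h, hb⟩
    simp only [Set.mem_iUnion]
    exact ⟨(s, n), Finset.mem_product.2 ⟨Finset.mem_range.2 (by omega), Finset.mem_range.2 (by omega)⟩, h, hb⟩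
  refine (measure_mono hsub).trans ((measure_biUnion_finset_le _ _).trans ?_)
  have hone : ∀ q ∈ Finset.range ℓ ×ˢ Finset.range ℓ, hiddenMeasure ℓ D
      {w : HW ℓ D | q.1 + q.2 < ℓ ∧ Bad D (100 * (ℓ * Real.log dM)) (extendW ℓ D w) q.1 q.2} ≤
      ENNReal.ofReal (Real.exp (-(11 * ℓ * m))) := by
    intro q _
    by_cases h : q.1 + q.2 < ℓ
    · have h1 := (Bad_bound hD hM (100 * (ℓ * Real.log dM)) q.1 q.2 h).trans
        (bad_numeric (ℓ := ℓ) (by omega) hM2)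
      refine (measure_mono fun w hw => hw.2).trans (h1.trans (ENNReal.ofReal_le_ofReal (Real.exp_le_exp.2 ?_)))
      have : (m:ℝ) ≤ D q.1 := by exact_mod_cast hm q.1 (by omega)
      have h0 : (0:ℝ) ≤ 11 * ℓ := by positivity
      nlinarith
    · simp [h]
  refine (Finset.sum_le_sum hone).trans ?_
  rw [Finset.sum_const, Finset.card_product, Finset.card_range, nsmul_eq_mul, ← ENNReal.ofReal_natCast,
    ← ENNReal.ofReal_mul (by positivity)]
  apply ENNReal.ofReal_le_ofReal
  have h1 : (ℓ:ℝ) ≤ Real.exp ℓ := by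
    have := Real.add_one_le_exp (ℓ:ℝ); linarith
  have hm' : (1:ℝ) ≤ m := by exact_mod_cast hm1
  push_cast
  calc (ℓ:ℝ) * ℓ * Real.exp (-(11*ℓ*m)) ≤ Real.exp ℓ * Real.exp ℓ * Real.exp (-(11*ℓ*m)) := by gcongr
    _ = Real.exp (ℓ + ℓ + -(11*ℓ*m)) := by rw [← Real.exp_add, ← Real.exp_add]
    _ ≤ _ := by
      apply Real.exp_le_exp.2
      have : (0:ℝ) ≤ ℓ := by positivity
      nlinarith

instance bitsMeasure_prob (ℓ : ℕ) (D : ℕ → ℕ) : IsProbabilityMeasure (bitsMeasure ℓ D) := by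
  unfold bitsMeasure; infer_instance

lemma bits_univ {ℓ : ℕ} {D : ℕ → ℕ} {P : HB ℓ D → Prop} (h : ∀ b, P b) : bitsMeasure ℓ D {b | P b} = 1 := by
  have : {b | P b} = Set.univ := Set.eq_univ_of_forall h
  rw [this, measure_univ]

lemma bn_pos_lt (D : ℕ → ℕ) (ℓ j : ℕ) (hj : 1 ≤ j) : ∀ i < bn D ℓ j, D (bn D ℓ j) < D i := by
  obtain ⟨j, rfl⟩ : ∃ j', j = j' + 1 := ⟨j - 1, by omega⟩
  intro i hi
  exact argminLt_lt D _ i hi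

theorem main_aux :
    ∃ C : ℝ, 0 < C ∧
      ∀ (ℓ : ℕ), 1 ≤ ℓ → ∀ (D : ℕ → ℕ) (δ : ℝ), δ ∈ Set.Ioo (0:ℝ) 1 →
      ((dminN ℓ D : ℝ) ≥
        (C * ℓ * Real.log (dmaxN ℓ D)) ^ (240 * (ℓ:ℝ)) * Real.log (1/δ)) →
      ∀ x : Fin (D 0) → ℝ, evNorm x = Real.sqrt (D 0) →
        hiddenMeasure ℓ D {w | ∀ y : Fin (D 0) → ℝ,
            evNorm (fun m => y m - x m) ≤ Rball ℓ D →
            ∀ j : ℕ, 1 ≤ j → bn D ℓ j ≠ 0 →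
              bitsMeasure ℓ D {b |
                specNorm (Mprod D (extendW ℓ D w) (extendB ℓ D b) y
                    (bn D ℓ (j+1)) (bn D ℓ j)) ≤
                  (C * ℓ * Real.log (dmaxN ℓ D)) ^
                    (((bn D ℓ j : ℝ) - (bn D ℓ (j+1) : ℝ)) / 2)} = 1} ≥
          ENNReal.ofReal (1 - δ) := by
  refine ⟨1000, by norm_num, ?_⟩
  intro ℓ hℓ D δ hδ hmin x hx
  have hlog0 : 0 ≤ Real.log (dmaxN ℓ D) := Real.log_natCast_nonneg _
  have hle1 : ENNReal.ofReal (1 - δ) ≤ 1 := by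
    rw [← ENNReal.ofReal_one]; exact ENNReal.ofReal_le_ofReal (by linarith [hδ.1])
  by_cases hM2 : dmaxN ℓ D < 2
  · -- degenerate widths
    have huniv : {w | ∀ y : Fin (D 0) → ℝ,
            evNorm (fun m => y m - x m) ≤ Rball ℓ D →
            ∀ j : ℕ, 1 ≤ j → bn D ℓ j ≠ 0 →
              bitsMeasure ℓ D {b |
                specNorm (Mprod D (extendW ℓ D w) (extendB ℓ D b) y
                    (bn D ℓ (j+1)) (bn D ℓ j)) ≤
                  (1000 * ℓ * Real.log (dmaxN ℓ D)) ^
                    (((bn D ℓ j : ℝ) - (bn D ℓ (j+1) : ℝ)) / 2)} = 1} = Set.univ := by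
      apply Set.eq_univ_of_forall
      intro w y _ j hj hj0
      apply bits_univ
      intro b
      refine (specNorm_zero_rows ?_ _).trans (Real.rpow_nonneg (by positivity) _)
      have h1 := bn_pos_lt D ℓ j hj 0 (by omega)
      have h2 := le_dmax ℓ D 0 (by omega)
      omega
    rw [huniv, measure_univ]
    exact hle1
  push Not at hM2
  set dM := dmaxN ℓ D with hdM
  set m := dminN ℓ D with hmdef
  set L := Real.log dM with hL
  have hL2 : Real.log 2 ≤ L := Real.log_le_log (by norm_num) (by exact_mod_cast hM2)
  have hl2 := Real.log_two_gt_d9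
  have hℓ' : (1:ℝ) ≤ ℓ := by exact_mod_cast hℓ
  have hbase : 690 * (ℓ:ℝ) ≤ 1000 * ℓ * L := by nlinarith
  have hbase1 : (1:ℝ) ≤ 1000 * ℓ * L := by nlinarith
  have hK : (690 * (ℓ:ℝ)) ^ ℓ ≤ (1000 * ℓ * L) ^ (240 * (ℓ:ℝ)) := by
    have e : (240 * (ℓ:ℝ)) = ((240 * ℓ : ℕ) : ℝ) := by push_cast; ring
    rw [e, Real.rpow_natCast]
    calc (690 * (ℓ:ℝ)) ^ ℓ ≤ (1000 * ℓ * L) ^ ℓ := by gcongr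
      _ ≤ _ := pow_le_pow_right₀ hbase1 (by omega)
  have hlogδ : 0 < Real.log (1/δ) := Real.log_pos (by rw [lt_div_iff₀ hδ.1]; linarith [hδ.2])
  have hm1 : 1 ≤ m := by
    have : (0:ℝ) < m := lt_of_lt_of_le (by positivity) hmin
    exact_mod_cast this
  have hmle : ∀ i ≤ ℓ, m ≤ D i := fun i hi => dmin_le ℓ D i hi
  have hD : ∀ i ≤ ℓ, 0 < D i := fun i hi => lt_of_lt_of_le hm1 (hmle i hi)
  have hMle : ∀ i ≤ ℓ, D i ≤ dM := fun i hi => le_dmax ℓ D i hi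
  have hc : (1:ℝ) ≤ 100 * (ℓ * L) := by nlinarith
  have hxn : nsq x = D 0 := by
    rw [evNorm_eq, Real.sqrt_inj (nsq_nonneg _) (by positivity)] at hx
    exact hx
  set BadU : Set (HW ℓ D) := {w : HW ℓ D | ∃ s n, s + n < ℓ ∧ Bad D (100 * (ℓ * L)) (extendW ℓ D w) s n} with hBadU
  have hBadP : hiddenMeasure ℓ D BadU ≤ ENNReal.ofReal (Real.exp (-(9 * ℓ * m))) :=
    extendW_bad_union hℓ hD hmle hm1 hMle hM2
  have hGood := LowGood_prob hD hmle x ℓ le_rfl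
  have hnum := final_numeric hℓ hm1 hδ hK hmin
  have hprob : ENNReal.ofReal (1 - δ) ≤ hiddenMeasure ℓ D (LowGood ℓ D x ℓ \ BadU) := by
    refine le_trans ?_ le_measure_sdiff
    calc ENNReal.ofReal (1 - δ) ≤ ENNReal.ofReal ((hiddenMeasure ℓ D).real (LowGood ℓ D x ℓ) - Real.exp (-(9 * ℓ * m))) :=
          ENNReal.ofReal_le_ofReal (by linarith)
      _ = hiddenMeasure ℓ D (LowGood ℓ D x ℓ) - ENNReal.ofReal (Real.exp (-(9 * ℓ * m))) := by
          rw [ENNReal.ofReal_sub _ (Real.exp_pos _).le, ofReal_measureReal]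
      _ ≤ _ := tsub_le_tsub_left hBadP _
  refine hprob.trans (measure_mono ?_)
  rintro w ⟨hw1, hw2⟩ y hy j hj hj0
  apply bits_univ
  intro b
  have hy2 : nsq (fun m => y m - x m) ≤ Rball ℓ D ^ 2 := by
    rw [evNorm_eq] at hy
    exact (Real.sqrt_le_left ((Real.sqrt_nonneg _).trans hy)).1 hy
  have hA : ∀ s n, s + n < ℓ → ¬ Bad D (100 * (ℓ * L)) (extendW ℓ D w) s n :=
    fun s n h hb => hw2 ⟨s, n, h, hb⟩
  have hfin := Mprod_bound hc hD hA x (fun k hk => LowGood_lower hD hxn hw1 k hk) (Rball ℓ D ^ 2) ?_ y hy2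
    (extendB ℓ D b) (bn D ℓ j) (by omega) (bn_le D ℓ j hj) (bn_pos_lt D ℓ j hj)
  · change specNorm (Mprod D (extendW ℓ D w) (extendB ℓ D b) y (argminLt D (bn D ℓ j)) (bn D ℓ j)) ≤
      (1000 * ℓ * L) ^ (((bn D ℓ j : ℝ) - (argminLt D (bn D ℓ j) : ℝ)) / 2)
    refine hfin.trans ?_
    have hlt := (argminLt_spec D (bn D ℓ j) (by omega)).1
    rw [Real.sqrt_eq_rpow, ← Real.rpow_natCast, ← Real.rpow_mul (by positivity), Nat.cast_sub hlt.le]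
    have hlt' : (argminLt D (bn D ℓ j) : ℝ) ≤ bn D ℓ j := by exact_mod_cast hlt.le
    rw [mul_one_div]
    apply Real.rpow_le_rpow (by positivity)
    · nlinarith
    · linarith
  · intro k hk i hi
    have hmpos : (0:ℝ) < m := by exact_mod_cast hm1
    have h1 := radius_numeric hk hL2 hmpos
    have h2 : (m:ℝ) ≤ D i := by exact_mod_cast hmle i hi
    exact lt_of_lt_of_le h1 h2

/-- **Statement 8** (Lemma 2.5 of the paper): with probability at least `1 − δ` over the
weights, for every `y ∈ B(x, R)` and every bottleneck segment, almost surely over the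
tie-breaking bits, `‖M_{i_j, i_{j+1}}(y)‖ ≤ (Cℓ log d_max)^{(i_j − i_{j+1})/2}`. -/
theorem stmt8 :
    ∃ C : ℝ, 0 < C ∧
      ∀ (ℓ : ℕ), 1 ≤ ℓ → ∀ (D : ℕ → ℕ) (δ : ℝ), δ ∈ Set.Ioo (0:ℝ) 1 →
      ((dminN ℓ D : ℝ) ≥
        (C * ℓ * Real.log (dmaxN ℓ D)) ^ (240 * (ℓ:ℝ)) * Real.log (1/δ)) →
      ∀ x : Fin (D 0) → ℝ, evNorm x = Real.sqrt (D 0) →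
        hiddenMeasure ℓ D {w | ∀ y : Fin (D 0) → ℝ,
            evNorm (fun m => y m - x m) ≤ Rball ℓ D →
            ∀ j : ℕ, 1 ≤ j → bn D ℓ j ≠ 0 →
              bitsMeasure ℓ D {b |
                specNorm (Mprod D (extendW ℓ D w) (extendB ℓ D b) y
                    (bn D ℓ (j+1)) (bn D ℓ j)) ≤
                  (C * ℓ * Real.log (dmaxN ℓ D)) ^
                    (((bn D ℓ j : ℝ) - (bn D ℓ (j+1) : ℝ)) / 2)} = 1} ≥
          ENNReal.ofReal (1 - δ) := by
  exact main_aux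

end
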